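/- arXiv:2407.12372 — 2 statements merged into one kernel-verified Lean document; each statement's English description precedes it below -/
import Mathlib

section
/- Let P, Q : ℝⁿ × ℝᵐ → ℝ be polynomials and let 𝒴 ⊆ ℝᵐ be a box. Then both the optimistic value function φ_o : ℝⁿ → ℝ ∪ {±∞} and the pessimistic value function φ_p : ℝⁿ → ℝ ∪ {±∞} of the associated bilevel problem are extended-real-valued semi-algebraic functions. -/
open Set

noncomputable section

/-- The lower-level argmin set `Θ(x) = {y ∈ 𝒴 : ∀ y' ∈ 𝒴, Q(x,y) ≤ Q(x,y')}`. -/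
def argminSet {n m : ℕ} (Q : (Fin n → ℝ) → (Fin m → ℝ) → ℝ) (Y : Set (Fin m → ℝ))
    (x : Fin n → ℝ) : Set (Fin m → ℝ) :=
  {y | y ∈ Y ∧ ∀ y' ∈ Y, Q x y ≤ Q x y'}

/-- Optimistic value function `φ_o(x) = inf_{y ∈ Θ(x)} P(x,y)`,
with the convention `inf ∅ = +∞`. -/
def valOpt {n m : ℕ} (P Q : (Fin n → ℝ) → (Fin m → ℝ) → ℝ) (Y : Set (Fin m → ℝ))
    (x : Fin n → ℝ) : EReal :=
  ⨅ y ∈ argminSet Q Y x, ((P x y : ℝ) : EReal)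

/-- Pessimistic value function `φ_p(x) = sup_{y ∈ Θ(x)} P(x,y)`,
with the convention `sup ∅ = -∞`. -/
def valPess {n m : ℕ} (P Q : (Fin n → ℝ) → (Fin m → ℝ) → ℝ) (Y : Set (Fin m → ℝ))
    (x : Fin n → ℝ) : EReal :=
  ⨆ y ∈ argminSet Q Y x, ((P x y : ℝ) : EReal)

/-- `P (x, y)` is a real polynomial in the joint variables `(x, y)`. -/
def IsPolyMap {n m : ℕ} (P : (Fin n → ℝ) → (Fin m → ℝ) → ℝ) : Prop :=
  ∃ p : MvPolynomial (Fin n ⊕ Fin m) ℝ,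
    ∀ x y, P x y = MvPolynomial.eval (Sum.elim x y) p

/-- Basic semi-algebraic subset of `ℝ^ι`. -/
def IsBasicSemialgebraic {ι : Type} [Fintype ι] (S : Set (ι → ℝ)) : Prop :=
  ∃ (p : MvPolynomial ι ℝ) (k : ℕ) (q : Fin k → MvPolynomial ι ℝ),
    S = {x | MvPolynomial.eval x p = 0 ∧ ∀ j, 0 < MvPolynomial.eval x (q j)}

/-- Semi-algebraic set: a finite union of basic semi-algebraic sets. -/
def IsSemialgebraic {ι : Type} [Fintype ι] (S : Set (ι → ℝ)) : Prop :=
  ∃ (N : ℕ) (T : Fin N → Set (ι → ℝ)),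
    (∀ i, IsBasicSemialgebraic (T i)) ∧ S = ⋃ i, T i

/-- Semi-algebraic real-valued function: its graph (inside `ℝ^{ι} × ℝ ≅ ℝ^{ι ⊕ Unit}`)
is semi-algebraic. -/
def IsSemialgebraicFun {ι : Type} [Fintype ι] (f : (ι → ℝ) → ℝ) : Prop :=
  IsSemialgebraic {z : (ι ⊕ Unit) → ℝ | f (z ∘ Sum.inl) = z (Sum.inr ())}

/-- Extended-real-valued semi-algebraic function: the sets where it is finite, `+∞`, `-∞`
are semi-algebraic, and the graph of its restriction to its (finite) domain is
semi-algebraic. -/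
def IsERealSemialgebraicFun {ι : Type} [Fintype ι] (h : (ι → ℝ) → EReal) : Prop :=
  IsSemialgebraic {x | ∃ r : ℝ, h x = (r : EReal)} ∧
  IsSemialgebraic {x | h x = ⊤} ∧
  IsSemialgebraic {x | h x = ⊥} ∧
  IsSemialgebraic {z : (ι ⊕ Unit) → ℝ | h (z ∘ Sum.inl) = ((z (Sum.inr ()) : ℝ) : EReal)}

/-- A (possibly unbounded) box `[a₁,b₁] × ⋯ × [aₘ,bₘ]` in `ℝ^m`, with
endpoints in `ℝ ∪ {±∞}`. -/
def IsBox {m : ℕ} (Y : Set (Fin m → ℝ)) : Prop :=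
  ∃ a b : Fin m → EReal,
    Y = {y | ∀ i, a i ≤ (y i : EReal) ∧ (y i : EReal) ≤ b i}

/-- The bounded box `[a₁,b₁] × ⋯ × [aₘ,bₘ]` with real endpoints. -/
def boundedBox {m : ℕ} (a b : Fin m → ℝ) : Set (Fin m → ℝ) :=
  {y | ∀ i, y i ∈ Set.Icc (a i) (b i)}

/-- Piecewise polynomial function: there is a finite partition of `ℝ^n` into pairwise
disjoint semi-algebraic sets on each of which `f` coincides with a polynomial. -/
def IsPiecewisePolynomial {n : ℕ} (f : (Fin n → ℝ) → ℝ) : Prop :=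
  ∃ (N : ℕ) (S : Fin N → Set (Fin n → ℝ)) (p : Fin N → MvPolynomial (Fin n) ℝ),
    (∀ i, IsSemialgebraic (S i)) ∧
    (∀ i j, i ≠ j → Disjoint (S i) (S j)) ∧
    (⋃ i, S i) = Set.univ ∧
    (∀ i, ∀ x ∈ S i, f x = MvPolynomial.eval x (p i))

open Polynomial Filter

/-! ### Constructible subsets of the real points of an `ℝ`-algebra -/

/-- Boolean combinations of the sets `{φ | 0 < φ r}` of real points, with `r ∈ G`. -/
inductive SignGenerated {R : Type} [CommRing R] [Algebra ℝ R] (G : Set R) :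
    Set (R →ₐ[ℝ] ℝ) → Prop
  | pos {r : R} (hr : r ∈ G) : SignGenerated G {φ | 0 < φ r}
  | compl {S : Set (R →ₐ[ℝ] ℝ)} (hS : SignGenerated G S) : SignGenerated G Sᶜ
  | inter {S T : Set (R →ₐ[ℝ] ℝ)} (hS : SignGenerated G S) (hT : SignGenerated G T) :
      SignGenerated G (S ∩ T)

/-- The semi-algebraic sets of real points of an `ℝ`-algebra. -/
def RealConstructible {R : Type} [CommRing R] [Algebra ℝ R] (S : Set (R →ₐ[ℝ] ℝ)) : Prop :=
  SignGenerated Set.univ S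

/-- Membership in a sign-generated set depends on the signs of finitely many generators. -/
theorem SignGenerated.exists_finset {R : Type} [CommRing R] [Algebra ℝ R] {G : Set R}
    {S : Set (R →ₐ[ℝ] ℝ)} (hS : SignGenerated G S) :
    ∃ F : Finset R, ↑F ⊆ G ∧
      ∀ φ ψ : R →ₐ[ℝ] ℝ, (∀ f ∈ F, (0 < φ f ↔ 0 < ψ f)) → (φ ∈ S ↔ ψ ∈ S) := by
  classical
  induction hS with
  | @pos r hr => exact ⟨{r}, by simpa using hr, fun φ ψ h => h r (by simp)⟩
  | compl _ ih =>
    obtain ⟨F, hF, h⟩ := ih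
    exact ⟨F, hF, fun φ ψ hs => not_congr (h φ ψ hs)⟩
  | inter _ _ ih₁ ih₂ =>
    obtain ⟨F₁, hF₁, h₁⟩ := ih₁
    obtain ⟨F₂, hF₂, h₂⟩ := ih₂
    refine ⟨F₁ ∪ F₂, by simp [hF₁, hF₂], fun φ ψ hs => and_congr (h₁ φ ψ ?_) (h₂ φ ψ ?_)⟩
    · exact fun f hf => hs f (by simp [hf])
    · exact fun f hf => hs f (by simp [hf])

theorem SignGenerated.realConstructible {R : Type} [CommRing R] [Algebra ℝ R] {G : Set R}
    {S : Set (R →ₐ[ℝ] ℝ)} (hS : SignGenerated G S) : RealConstructible S := by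
  induction hS with
  | pos _ => exact .pos (Set.mem_univ _)
  | compl _ ih => exact .compl ih
  | inter _ _ ih₁ ih₂ => exact .inter ih₁ ih₂

namespace RealConstructible

variable {R R' : Type} [CommRing R] [Algebra ℝ R] [CommRing R'] [Algebra ℝ R']
  {S T : Set (R →ₐ[ℝ] ℝ)}

theorem pos (r : R) : RealConstructible {φ : R →ₐ[ℝ] ℝ | 0 < φ r} :=
  SignGenerated.pos (Set.mem_univ r)

theorem compl (hS : RealConstructible S) : RealConstructible Sᶜ :=
  SignGenerated.compl hS

theorem inter (hS : RealConstructible S) (hT : RealConstructible T) :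
    RealConstructible (S ∩ T) :=
  SignGenerated.inter hS hT

theorem union (hS : RealConstructible S) (hT : RealConstructible T) :
    RealConstructible (S ∪ T) := by
  have := (hS.compl.inter hT.compl).compl
  rwa [← Set.compl_union, compl_compl] at this

theorem univ : RealConstructible (Set.univ : Set (R →ₐ[ℝ] ℝ)) := by
  have := (pos (0 : R)).union (pos (0 : R)).compl
  rwa [Set.union_compl_self] at this

theorem empty : RealConstructible (∅ : Set (R →ₐ[ℝ] ℝ)) := by
  simpa using (univ (R := R)).compl

theorem ne_zero (r : R) : RealConstructible {φ : R →ₐ[ℝ] ℝ | φ r ≠ 0} := by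
  convert (pos r).union (pos (-r)) using 1
  ext φ
  simp [lt_or_lt_iff_ne, eq_comm]

theorem eq_zero (r : R) : RealConstructible {φ : R →ₐ[ℝ] ℝ | φ r = 0} := by
  convert (ne_zero r).compl using 1
  ext φ
  simp

theorem biUnion {α : Type} (F : Finset α) {S : α → Set (R →ₐ[ℝ] ℝ)}
    (hS : ∀ f ∈ F, RealConstructible (S f)) : RealConstructible (⋃ f ∈ F, S f) := by
  classical
  induction F using Finset.induction_on with
  | empty => simpa using empty
  | insert a F _ ih =>
    rw [Finset.set_biUnion_insert]
    exact (hS a (by simp)).union (ih fun f hf => hS f (by simp [hf]))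

theorem biInter {α : Type} (F : Finset α) {S : α → Set (R →ₐ[ℝ] ℝ)}
    (hS : ∀ f ∈ F, RealConstructible (S f)) : RealConstructible (⋂ f ∈ F, S f) := by
  have := (biUnion F fun f hf => (hS f hf).compl).compl
  simpa only [Set.compl_iUnion, compl_compl] using this

theorem comap (h : R →ₐ[ℝ] R') (hS : RealConstructible S) :
    RealConstructible {ψ : R' →ₐ[ℝ] ℝ | ψ.comp h ∈ S} := by
  induction hS with
  | @pos r _ => exact pos (h r)
  | compl _ ih => exact ih.compl
  | inter _ _ ih₁ ih₂ => exact ih₁.inter ih₂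

end RealConstructible

/-! ### Real points of a polynomial algebra -/

section EvalAt

variable {R : Type} [CommRing R] [Algebra ℝ R]

/-- The real point of `R[X]` lying over `φ` at which `X` takes the value `y`. -/
def evalAt (φ : R →ₐ[ℝ] ℝ) (y : ℝ) : R[X] →ₐ[ℝ] ℝ :=
  (aeval y : ℝ[X] →ₐ[ℝ] ℝ).comp (Polynomial.mapAlgHom φ)

theorem evalAt_apply (φ : R →ₐ[ℝ] ℝ) (y : ℝ) (p : R[X]) :
    evalAt φ y p = (p.map (φ : R →+* ℝ)).eval y := by
  simp [evalAt]

@[simp] theorem evalAt_C (φ : R →ₐ[ℝ] ℝ) (y : ℝ) (r : R) : evalAt φ y (C r) = φ r := by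
  simp [evalAt_apply]

@[simp] theorem evalAt_X (φ : R →ₐ[ℝ] ℝ) (y : ℝ) : evalAt φ y X = y := by
  simp [evalAt_apply]

theorem algHom_polynomial_ext {φ ψ : R[X] →ₐ[ℝ] ℝ} (hC : ∀ r, φ (C r) = ψ (C r))
    (hX : φ X = ψ X) : φ = ψ := by
  ext r
  · exact hC r
  · exact hX

@[simp] theorem map_C_map_evalAt (φ : R →ₐ[ℝ] ℝ) (y : ℝ) (p : R[X]) :
    (p.map C).map (evalAt φ y : R[X] →+* ℝ) = p.map (φ : R →+* ℝ) := by
  ext n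
  simp

end EvalAt

/-! ### Signs at infinity -/

theorem eventually_pos_or_eventually_not_pos (p : ℝ[X]) :
    (∀ᶠ y in atTop, 0 < p.eval y) ∨ ∀ᶠ y in atTop, ¬ 0 < p.eval y := by
  rcases le_or_gt p.degree 0 with h | h
  · rw [eq_C_of_degree_le_zero h]
    by_cases h0 : 0 < p.coeff 0 <;> simp [h0]
  · rcases le_total 0 p.leadingCoeff with hl | hl
    · exact Or.inl ((p.tendsto_atTop_of_leadingCoeff_nonneg h hl).eventually_gt_atTop 0)
    · right
      filter_upwards [(p.tendsto_atBot_of_leadingCoeff_nonpos h hl).eventually_le_atBot 0]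
        with y hy using not_lt.mpr hy

theorem eventually_pos_iff_leadingCoeff_pos (p : ℝ[X]) :
    (∀ᶠ y in atTop, 0 < p.eval y) ↔ 0 < p.leadingCoeff := by
  rcases le_or_gt p.degree 0 with h | h
  · rw [eq_C_of_degree_le_zero h]
    simp only [eval_C, eventually_const, leadingCoeff_C]
  · refine ⟨fun hy => ?_, fun hl =>
      (p.tendsto_atTop_of_leadingCoeff_nonneg h hl.le).eventually_gt_atTop 0⟩
    by_contra hl
    have := (p.tendsto_atBot_of_leadingCoeff_nonpos h (not_lt.mp hl)).eventually_le_atBot 0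
    obtain ⟨y, h₁, h₂⟩ := (hy.and this).exists
    exact absurd h₁ (not_lt.mpr h₂)

namespace RealConstructible

variable {R : Type} [CommRing R] [Algebra ℝ R]

theorem eventually_atTop_pos (d : ℕ) (p : R[X]) (hp : p.natDegree ≤ d) :
    RealConstructible {φ : R →ₐ[ℝ] ℝ | ∀ᶠ y in atTop, 0 < evalAt φ y p} := by
  induction d generalizing p with
  | zero =>
    rw [eq_C_of_natDegree_le_zero hp]
    simpa only [evalAt_C, eventually_const] using pos (p.coeff 0)
  | succ d ih =>
    have hq : (p - C (p.coeff (d + 1)) * X ^ (d + 1)).natDegree ≤ d := by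
      refine natDegree_le_iff_coeff_eq_zero.mpr fun n hn => ?_
      rcases eq_or_ne n (d + 1) with rfl | hne
      · simp
      · simp [coeff_X_pow, hne, coeff_eq_zero_of_natDegree_lt (show p.natDegree < n by omega)]
    convert (pos (p.coeff (d + 1))).union ((eq_zero (p.coeff (d + 1))).inter (ih _ hq)) using 1
    ext φ
    simp only [Set.mem_ofPred_eq, Set.mem_union, Set.mem_inter_iff]
    by_cases h0 : φ (p.coeff (d + 1)) = 0
    · simp [h0]
    · have hd : (p.map (φ : R →+* ℝ)).natDegree = d + 1 :=
        le_antisymm (natDegree_map_le.trans hp) (le_natDegree_of_ne_zero (by simpa using h0))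
      have hl : (p.map (φ : R →+* ℝ)).leadingCoeff = φ (p.coeff (d + 1)) := by
        simp [leadingCoeff, hd]
      simp only [evalAt_apply]
      rw [eventually_pos_iff_leadingCoeff_pos, hl]
      simp [h0]

theorem eventually_atTop {S : Set (R[X] →ₐ[ℝ] ℝ)} (hS : RealConstructible S) :
    RealConstructible {φ : R →ₐ[ℝ] ℝ | ∀ᶠ y in atTop, evalAt φ y ∈ S} := by
  suffices h : RealConstructible {φ : R →ₐ[ℝ] ℝ | ∀ᶠ y in atTop, evalAt φ y ∈ S} ∧
      ∀ φ : R →ₐ[ℝ] ℝ, (∀ᶠ y in atTop, evalAt φ y ∈ S) ∨ ∀ᶠ y in atTop, evalAt φ y ∉ S from h.1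
  induction hS with
  | @pos r _ =>
    refine ⟨eventually_atTop_pos _ r le_rfl, fun φ => ?_⟩
    simpa [evalAt_apply] using eventually_pos_or_eventually_not_pos (r.map (φ : R →+* ℝ))
  | @compl S _ ih =>
    refine ⟨?_, fun φ => ?_⟩
    · convert ih.1.compl using 1
      ext φ
      simp only [Set.mem_ofPred_eq, Set.mem_compl_iff]
      refine ⟨fun h h' => ?_, fun h => (ih.2 φ).resolve_left h⟩
      obtain ⟨y, h₁, h₂⟩ := (h.and h').exists
      exact h₁ h₂
    · simpa [or_comm] using ih.2 φ
  | @inter S T _ _ ih₁ ih₂ =>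
    refine ⟨?_, fun φ => ?_⟩
    · convert ih₁.1.inter ih₂.1 using 1
      ext φ
      simp only [Set.mem_ofPred_eq, Set.mem_inter_iff, eventually_and]
    · rcases ih₁.2 φ with h₁ | h₁
      · rcases ih₂.2 φ with h₂ | h₂
        · exact Or.inl (h₁.and h₂)
        · exact Or.inr (h₂.mono fun y hy h => hy h.2)
      · exact Or.inr (h₁.mono fun y hy h => hy h.1)

theorem eventually_atBot {S : Set (R[X] →ₐ[ℝ] ℝ)} (hS : RealConstructible S) :
    RealConstructible {φ : R →ₐ[ℝ] ℝ | ∀ᶠ y in atBot, evalAt φ y ∈ S} := by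
  convert eventually_atTop (hS.comap ((aeval (-X : R[X])).restrictScalars ℝ)) using 1
  ext φ
  have : ∀ y, (evalAt φ y).comp ((aeval (-X : R[X])).restrictScalars ℝ) = evalAt φ (-y) :=
    fun y => algHom_polynomial_ext (by simp) (by simp)
  simp only [Set.mem_ofPred_eq, this]
  rw [← map_neg_atTop, eventually_map]

end RealConstructible

/-! ### Pseudo-division -/

section PseudoDivision

variable {R : Type} [CommRing R]

theorem exists_natDegree_le_sub_mul {p f : R[X]} {d n : ℕ} (hp : p.natDegree ≤ d + 1)
    (hf : f.natDegree ≤ n) :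
    ∃ (k : ℕ) (q : R[X]),
      (C (p.coeff (d + 1)) ^ (2 * k) * f - p * q).natDegree ≤ d := by
  induction n generalizing f with
  | zero => exact ⟨0, 0, by simpa using hf.trans (Nat.zero_le d)⟩
  | succ n ih =>
    rcases le_or_gt (n + 1) d with hnd | hnd
    · exact ⟨0, 0, by simpa using hf.trans hnd⟩
    set c := p.coeff (d + 1)
    set s : R[X] := C (c * f.coeff (n + 1)) * X ^ (n - d) with hs
    have hg : (C c ^ 2 * f - p * s).natDegree ≤ n := by
      have h₁ : (C c ^ 2 * f).natDegree ≤ n + 1 := by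
        rw [← C_pow]
        exact (natDegree_C_mul_le _ _).trans hf
      have h₂ : (p * s).natDegree ≤ n + 1 := by
        refine natDegree_mul_le.trans ?_
        have : s.natDegree ≤ n - d := natDegree_C_mul_X_pow_le _ _
        omega
      refine natDegree_le_iff_coeff_eq_zero.mpr fun i hi => ?_
      rcases eq_or_ne i (n + 1) with rfl | hne
      · have h₃ : (p * s).coeff (n + 1) = c * (c * f.coeff (n + 1)) := by
          rw [hs, mul_comm p, mul_assoc, coeff_C_mul, X_pow_mul,
            show n + 1 = (d + 1) + (n - d) by omega, coeff_mul_X_pow]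
          ring
        rw [coeff_sub, h₃, ← C_pow, coeff_C_mul]
        ring
      · rw [coeff_sub, coeff_eq_zero_of_natDegree_lt (by omega),
          coeff_eq_zero_of_natDegree_lt (by omega), sub_zero]
    obtain ⟨k, q, hq⟩ := ih hg
    refine ⟨k + 1, C c ^ (2 * k) * s + q, ?_⟩
    convert hq using 2
    ring

end PseudoDivision

theorem SignGenerated.exists_lowDegree {R : Type} [CommRing R] [Algebra ℝ R] {p : R[X]} {d : ℕ}
    (hp : p.natDegree ≤ d + 1) {S : Set (R[X] →ₐ[ℝ] ℝ)} (hS : RealConstructible S) :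
    ∃ T, SignGenerated {f : R[X] | f.natDegree ≤ d} T ∧ ∀ ψ : R[X] →ₐ[ℝ] ℝ,
      ψ (C (p.coeff (d + 1))) ≠ 0 → ψ p = 0 → (ψ ∈ S ↔ ψ ∈ T) := by
  induction hS with
  | @pos f _ =>
    obtain ⟨k, q, hq⟩ := exists_natDegree_le_sub_mul hp (le_refl f.natDegree)
    refine ⟨_, .pos hq, fun ψ hc h0 => ?_⟩
    have : 0 < ψ (C (p.coeff (d + 1))) ^ (2 * k) := by
      rw [pow_mul]
      positivity
    simp [h0, mul_pos_iff_of_pos_left this]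
  | compl _ ih =>
    obtain ⟨T, hT, h⟩ := ih
    exact ⟨Tᶜ, hT.compl, fun ψ hc h0 => not_congr (h ψ hc h0)⟩
  | inter _ _ ih₁ ih₂ =>
    obtain ⟨T₁, hT₁, h₁⟩ := ih₁
    obtain ⟨T₂, hT₂, h₂⟩ := ih₂
    exact ⟨T₁ ∩ T₂, hT₁.inter hT₂, fun ψ hc h0 => and_congr (h₁ ψ hc h0) (h₂ ψ hc h0)⟩

/-! ### Intervals free of roots -/

/-- No nonzero member of the family `F` has a root in `s`. -/
def RootFree (F : Finset ℝ[X]) (s : Set ℝ) : Prop :=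
  ∀ f ∈ F, f ≠ 0 → ∀ w ∈ s, f.eval w ≠ 0

/-- The predicate `T` holds at some root of a nonzero member of `F`, or near `-∞`. -/
def HasLowerEndpoint (F : Finset ℝ[X]) (T : ℝ → Prop) : Prop :=
  (∃ f ∈ F, f ≠ 0 ∧ ∃ u, f.eval u = 0 ∧ T u) ∨ ∀ᶠ u in atBot, T u

/-- The predicate `T` holds at some root of a nonzero member of `F`, or near `+∞`. -/
def HasUpperEndpoint (F : Finset ℝ[X]) (T : ℝ → Prop) : Prop :=
  (∃ f ∈ F, f ≠ 0 ∧ ∃ u, f.eval u = 0 ∧ T u) ∨ ∀ᶠ u in atTop, T u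

theorem HasLowerEndpoint.exists {F : Finset ℝ[X]} {T : ℝ → Prop} (h : HasLowerEndpoint F T) :
    ∃ u, T u := by
  rcases h with ⟨f, _, _, u, _, hu⟩ | h
  exacts [⟨u, hu⟩, h.exists]

theorem HasUpperEndpoint.exists {F : Finset ℝ[X]} {T : ℝ → Prop} (h : HasUpperEndpoint F T) :
    ∃ u, T u := by
  rcases h with ⟨f, _, _, u, _, hu⟩ | h
  exacts [⟨u, hu⟩, h.exists]

theorem finite_roots_of_family (F : Finset ℝ[X]) :
    {w : ℝ | ∃ f ∈ F, f ≠ 0 ∧ f.eval w = 0}.Finite := by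
  classical
  refine (F.biUnion fun f => f.roots.toFinset).finite_toSet.subset ?_
  rintro w ⟨f, hf, h0, hw⟩
  simp only [Finset.coe_biUnion, Set.mem_iUnion]
  exact ⟨f, hf, by simp [h0, hw]⟩

theorem hasLowerEndpoint_of_forall {F : Finset ℝ[X]} {T : ℝ → Prop} {y : ℝ}
    (hy : RootFree F {y}) (hT : ∀ u < y, RootFree F (Set.Ioc u y) → T u) :
    HasLowerEndpoint F T := by
  have hfree : ∀ u, (∀ w ∈ {w | ∃ f ∈ F, f ≠ 0 ∧ f.eval w = 0} ∩ Set.Iio y, w ≤ u) →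
      RootFree F (Set.Ioc u y) := by
    intro u hu f hf h0 w hw hfw
    rcases hw.2.eq_or_lt with rfl | hlt
    · exact hy f hf h0 w rfl hfw
    · exact absurd (hu w ⟨⟨f, hf, h0, hfw⟩, hlt⟩) (not_le.mpr hw.1)
  have hfin := (finite_roots_of_family F).inter_of_left (Set.Iio y)
  rcases Set.eq_empty_or_nonempty
    ({w | ∃ f ∈ F, f ≠ 0 ∧ f.eval w = 0} ∩ Set.Iio y) with he | hne
  · right
    filter_upwards [eventually_lt_atBot y] with u hu
    exact hT u hu (hfree u (by simp [he]))
  · obtain ⟨u, ⟨⟨f, hf, h0, hu⟩, huy⟩, hmax⟩ := Set.exists_max_image _ id hfin hne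
    exact Or.inl ⟨f, hf, h0, u, hu, hT u huy (hfree u hmax)⟩

theorem hasUpperEndpoint_of_forall {F : Finset ℝ[X]} {T : ℝ → Prop} {y : ℝ}
    (hy : RootFree F {y}) (hT : ∀ v > y, RootFree F (Set.Ico y v) → T v) :
    HasUpperEndpoint F T := by
  have hfree : ∀ v, (∀ w ∈ {w | ∃ f ∈ F, f ≠ 0 ∧ f.eval w = 0} ∩ Set.Ioi y, v ≤ w) →
      RootFree F (Set.Ico y v) := by
    intro v hv f hf h0 w hw hfw
    rcases hw.1.eq_or_lt with rfl | hlt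
    · exact hy f hf h0 _ rfl hfw
    · exact absurd (hv w ⟨⟨f, hf, h0, hfw⟩, hlt⟩) (not_le.mpr hw.2)
  have hfin := (finite_roots_of_family F).inter_of_left (Set.Ioi y)
  rcases Set.eq_empty_or_nonempty
    ({w | ∃ f ∈ F, f ≠ 0 ∧ f.eval w = 0} ∩ Set.Ioi y) with he | hne
  · right
    filter_upwards [eventually_gt_atTop y] with v hv
    exact hT v hv (hfree v (by simp [he]))
  · obtain ⟨v, ⟨⟨f, hf, h0, hv⟩, hvy⟩, hmin⟩ := Set.exists_min_image _ id hfin hne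
    exact Or.inl ⟨f, hf, h0, v, hv, hT v hvy (hfree v hmin)⟩

/-- `T u v` holds for consecutive roots `u < v` of the nonzero members of `F`, or for
suitable substitutes when the interval between consecutive roots is unbounded. -/
def HasRootFreeInterval (F : Finset ℝ[X]) (T : ℝ → ℝ → Prop) : Prop :=
  HasLowerEndpoint F fun u => HasUpperEndpoint F fun v =>
    (u < v ∧ RootFree F (Set.Ioo u v)) ∧ T u v

theorem HasRootFreeInterval.exists {F : Finset ℝ[X]} {T : ℝ → ℝ → Prop}
    (h : HasRootFreeInterval F T) : ∃ u v, u < v ∧ RootFree F (Set.Ioo u v) ∧ T u v := by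
  obtain ⟨u, hu⟩ := HasLowerEndpoint.exists h
  obtain ⟨v, hv⟩ := hu.exists
  exact ⟨u, v, hv.1.1, hv.1.2, hv.2⟩

theorem hasRootFreeInterval_of_forall {F : Finset ℝ[X]} {T : ℝ → ℝ → Prop} {y : ℝ}
    (hy : RootFree F {y})
    (hT : ∀ u v, u < y → y < v → RootFree F (Set.Ioo u v) → T u v) :
    HasRootFreeInterval F T := by
  refine hasLowerEndpoint_of_forall hy fun u hu hFu =>
    hasUpperEndpoint_of_forall hy fun v hv hFv => ?_
  have hF : RootFree F (Set.Ioo u v) := by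
    intro f hf h0 w hw
    rcases le_total w y with h | h
    · exact hFu f hf h0 w ⟨hw.1, h⟩
    · exact hFv f hf h0 w ⟨h, hw.2⟩
  exact ⟨⟨hu.trans hv, hF⟩, hT u v hu hv hF⟩

theorem eval_pos_iff_of_rootFree {f : ℝ[X]} {s : Set ℝ} (hs : s.OrdConnected)
    (hf : f ≠ 0 → ∀ w ∈ s, f.eval w ≠ 0) {y z : ℝ} (hy : y ∈ s) (hz : z ∈ s) :
    0 < f.eval y ↔ 0 < f.eval z := by
  have key : ∀ {a b : ℝ}, a ∈ s → b ∈ s → 0 < f.eval a → 0 < f.eval b := by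
    intro a b ha hb hpos
    by_contra hneg
    have h0 : f ≠ 0 := by
      rintro rfl
      simp at hpos
    have hmem : (0 : ℝ) ∈ (fun t => f.eval t) '' Set.uIcc b a :=
      intermediate_value_uIcc f.continuous.continuousOn
        (Set.mem_uIcc.mpr (Or.inl ⟨not_lt.mp hneg, hpos.le⟩))
    obtain ⟨w, hw, hfw⟩ := hmem
    exact hf h0 w (hs.uIcc_subset hb ha hw) hfw
  exact ⟨key hy hz, key hz hy⟩

theorem eval_mul_eval_neg_of_derivative_ne_zero {p : ℝ[X]} {u v y : ℝ}
    (hp : ∀ w ∈ Set.Ioo u v, p.derivative.eval w ≠ 0) (huy : u < y) (hyv : y < v)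
    (hy : p.eval y = 0) : p.eval u * p.eval v < 0 := by
  have hsign := fun z (hz : z ∈ Set.Ioo u v) =>
    eval_pos_iff_of_rootFree Set.ordConnected_Ioo (fun _ => hp) ⟨huy, hyv⟩ hz
  have hint : interior (Set.Icc u v) = Set.Ioo u v := interior_Icc
  have hu : u ∈ Set.Icc u v := ⟨le_rfl, (huy.trans hyv).le⟩
  have hv : v ∈ Set.Icc u v := ⟨(huy.trans hyv).le, le_rfl⟩
  have hym : y ∈ Set.Icc u v := ⟨huy.le, hyv.le⟩
  by_cases hpos : 0 < p.derivative.eval y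
  · have hmono : StrictMonoOn (fun t => p.eval t) (Set.Icc u v) := by
      refine strictMonoOn_of_deriv_pos (convex_Icc u v) p.continuous.continuousOn fun z hz => ?_
      rw [hint] at hz
      simpa using (hsign z hz).mp hpos
    have h₁ := hmono hu hym huy
    have h₂ := hmono hym hv hyv
    simp only [hy] at h₁ h₂
    exact mul_neg_of_neg_of_pos h₁ h₂
  · have hanti : StrictAntiOn (fun t => p.eval t) (Set.Icc u v) := by
      refine strictAntiOn_of_deriv_neg (convex_Icc u v) p.continuous.continuousOn fun z hz => ?_
      rw [hint] at hz
      have := mt (hsign z hz).mpr hpos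
      simpa using lt_of_le_of_ne (not_lt.mp this) (hp z hz)
    have h₁ := hanti hu hym huy
    have h₂ := hanti hym hv hyv
    simp only [hy] at h₁ h₂
    exact mul_neg_of_pos_of_neg h₁ h₂

theorem exists_iff_hasRootFreeInterval {F : Finset ℝ[X]} {s : ℝ → Prop}
    (hs : ∀ y z, (∀ f ∈ F, (0 < f.eval y ↔ 0 < f.eval z)) → (s y ↔ s z)) :
    (∃ y, s y) ↔ (∃ f ∈ F, f ≠ 0 ∧ ∃ y, f.eval y = 0 ∧ s y) ∨
      HasRootFreeInterval F fun u v => s ((u + v) / 2) := by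
  constructor
  · rintro ⟨y, hsy⟩
    by_cases hy : RootFree F {y}
    · refine Or.inr (hasRootFreeInterval_of_forall hy fun u v hu hv hF => ?_)
      refine (hs y _ fun f hf => ?_).mp hsy
      exact eval_pos_iff_of_rootFree Set.ordConnected_Ioo (hF f hf) ⟨hu, hv⟩
        ⟨by linarith, by linarith⟩
    · simp only [RootFree, Set.mem_singleton_iff, forall_eq, not_forall, not_not] at hy
      obtain ⟨f, hf, h0, hfy⟩ := hy
      exact Or.inl ⟨f, hf, h0, y, hfy, hsy⟩
  · rintro (⟨f, _, _, y, _, hsy⟩ | h)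
    · exact ⟨y, hsy⟩
    · obtain ⟨u, v, _, _, h⟩ := h.exists
      exact ⟨_, h⟩

theorem exists_root_iff_hasRootFreeInterval {F : Finset ℝ[X]} {p : ℝ[X]} {s : ℝ → Prop}
    (hp : p.derivative ∈ F) (hp0 : p.derivative ≠ 0)
    (hs : ∀ y z, (∀ f ∈ F, (0 < f.eval y ↔ 0 < f.eval z)) → (s y ↔ s z)) :
    (∃ y, p.eval y = 0 ∧ s y) ↔
      (∃ f ∈ F, f ≠ 0 ∧ ∃ y, f.eval y = 0 ∧ p.eval y = 0 ∧ s y) ∨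
      HasRootFreeInterval F fun u v => p.eval u * p.eval v < 0 ∧ s ((u + v) / 2) := by
  have hmid : ∀ {u v y}, u < y → y < v → RootFree F (Set.Ioo u v) →
      (s y ↔ s ((u + v) / 2)) := fun hu hv hF => hs _ _ fun f hf =>
    eval_pos_iff_of_rootFree Set.ordConnected_Ioo (hF f hf) ⟨hu, hv⟩
      ⟨by linarith, by linarith⟩
  constructor
  · rintro ⟨y, hpy, hsy⟩
    by_cases hy : RootFree F {y}
    · refine Or.inr (hasRootFreeInterval_of_forall hy fun u v hu hv hF => ⟨?_, ?_⟩)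
      · exact eval_mul_eval_neg_of_derivative_ne_zero (hF _ hp hp0) hu hv hpy
      · exact (hmid hu hv hF).mp hsy
    · simp only [RootFree, Set.mem_singleton_iff, forall_eq, not_forall, not_not] at hy
      obtain ⟨f, hf, h0, hfy⟩ := hy
      exact Or.inl ⟨f, hf, h0, y, hfy, hpy, hsy⟩
  · rintro (⟨f, _, _, y, _, hy⟩ | h)
    · exact ⟨y, hy⟩
    · obtain ⟨u, v, huv, hF, hneg, hsm⟩ := h.exists
      have hmem : (0 : ℝ) ∈ (fun t => p.eval t) '' Set.uIcc u v := by
        refine intermediate_value_uIcc p.continuous.continuousOn (Set.mem_uIcc.mpr ?_)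
        rcases mul_neg_iff.mp hneg with h | h
        · exact Or.inr ⟨h.2.le, h.1.le⟩
        · exact Or.inl ⟨h.1.le, h.2.le⟩
      obtain ⟨y, hy, hpy⟩ := hmem
      rw [Set.uIcc_of_le huv.le] at hy
      simp only at hpy
      have hu : u ≠ y := by
        rintro rfl
        simp [hpy] at hneg
      have hv : y ≠ v := by
        rintro rfl
        simp [hpy] at hneg
      exact ⟨y, hpy, (hmid (lt_of_le_of_ne hy.1 hu) (lt_of_le_of_ne hy.2 hv) hF).mpr hsm⟩

/-! ### Elimination of a real root -/

/-- Quantifiers ranging over the real roots of a polynomial of degree at most `d` preserve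
constructibility. -/
def RootElimination (d : ℕ) : Prop :=
  ∀ (R : Type) [CommRing R] [Algebra ℝ R] (p : R[X]), p.natDegree ≤ d →
    ∀ S : Set (R[X] →ₐ[ℝ] ℝ), RealConstructible S →
      RealConstructible {φ : R →ₐ[ℝ] ℝ | p.map (φ : R →+* ℝ) ≠ 0 ∧
        ∃ y, (p.map (φ : R →+* ℝ)).eval y = 0 ∧ evalAt φ y ∈ S}

section Elimination

open Classical in
/-- The family of real polynomials obtained by specializing coefficients at `φ`. -/
def specialize {R : Type} [CommRing R] [Algebra ℝ R] (φ : R →ₐ[ℝ] ℝ) (F : Finset R[X]) :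
    Finset ℝ[X] :=
  F.image fun f => f.map (φ : R →+* ℝ)

variable {R : Type} [CommRing R] [Algebra ℝ R] {d : ℕ} {F : Finset R[X]}

theorem forall_mem_specialize {φ : R →ₐ[ℝ] ℝ} {P : ℝ[X] → Prop} :
    (∀ f ∈ specialize φ F, P f) ↔ ∀ f ∈ F, P (f.map (φ : R →+* ℝ)) := by
  simp [specialize]

theorem exists_mem_specialize {φ : R →ₐ[ℝ] ℝ} {P : ℝ[X] → Prop} :
    (∃ f ∈ specialize φ F, P f) ↔ ∃ f ∈ F, P (f.map (φ : R →+* ℝ)) := by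
  simp [specialize]

open Classical in
/-- The family `F` regarded over the polynomial extension of the coefficient ring. -/
def extendCoeffs (F : Finset R[X]) : Finset R[X][X] :=
  F.image fun f => f.map C

theorem specialize_extendCoeffs (φ : R →ₐ[ℝ] ℝ) (y : ℝ) :
    specialize (evalAt φ y) (extendCoeffs F) = specialize φ F := by
  classical
  simp only [specialize, extendCoeffs, Finset.image_image, Function.comp_def, map_C_map_evalAt]

theorem natDegree_le_of_mem_extendCoeffs {A : Type} [CommRing A] {d : ℕ} {F : Finset A[X]}
    (hF : ∀ f ∈ F, f.natDegree ≤ d) : ∀ f ∈ extendCoeffs F, f.natDegree ≤ d := by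
  simp only [extendCoeffs, Finset.mem_image]
  rintro _ ⟨f, hf, rfl⟩
  exact natDegree_map_le.trans (hF f hf)

namespace RootElimination

theorem exists_root (h : RootElimination d) (hF : ∀ f ∈ F, f.natDegree ≤ d)
    {S : Set (R[X] →ₐ[ℝ] ℝ)} (hS : RealConstructible S) :
    RealConstructible {φ : R →ₐ[ℝ] ℝ |
      ∃ f ∈ specialize φ F, f ≠ 0 ∧ ∃ y, f.eval y = 0 ∧ evalAt φ y ∈ S} := by
  convert RealConstructible.biUnion F fun f hf => h R f (hF f hf) S hS using 1
  ext φ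
  simp only [exists_mem_specialize, Set.mem_ofPred_eq, Set.mem_iUnion, exists_prop]

theorem rootFree (h : RootElimination d) (hF : ∀ f ∈ F, f.natDegree ≤ d)
    {S : Set (R[X] →ₐ[ℝ] ℝ)} (hS : RealConstructible S) :
    RealConstructible {φ : R →ₐ[ℝ] ℝ | RootFree (specialize φ F) {w | evalAt φ w ∈ S}} := by
  convert (h.exists_root hF hS).compl using 1
  ext φ
  simp only [RootFree, Set.mem_ofPred_eq, Set.mem_compl_iff]
  push Not
  exact forall₄_congr fun f _ _ w => imp_not_comm

theorem hasLowerEndpoint (h : RootElimination d) (hF : ∀ f ∈ F, f.natDegree ≤ d)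
    {S : Set (R[X] →ₐ[ℝ] ℝ)} (hS : RealConstructible S) :
    RealConstructible {φ : R →ₐ[ℝ] ℝ |
      HasLowerEndpoint (specialize φ F) fun u => evalAt φ u ∈ S} :=
  (h.exists_root hF hS).union hS.eventually_atBot

theorem hasUpperEndpoint (h : RootElimination d) (hF : ∀ f ∈ F, f.natDegree ≤ d)
    {S : Set (R[X] →ₐ[ℝ] ℝ)} (hS : RealConstructible S) :
    RealConstructible {φ : R →ₐ[ℝ] ℝ |
      HasUpperEndpoint (specialize φ F) fun u => evalAt φ u ∈ S} :=
  (h.exists_root hF hS).union hS.eventually_atTop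

theorem hasRootFreeInterval (h : RootElimination d) (hF : ∀ f ∈ F, f.natDegree ≤ d)
    {T : Set (R[X][X] →ₐ[ℝ] ℝ)} (hT : RealConstructible T) :
    RealConstructible {φ : R →ₐ[ℝ] ℝ |
      HasRootFreeInterval (specialize φ F) fun u v => evalAt (evalAt φ u) v ∈ T} := by
  have hF₁ := natDegree_le_of_mem_extendCoeffs hF
  have hF₂ := natDegree_le_of_mem_extendCoeffs hF₁
  have hlt : RealConstructible {χ : R[X][X] →ₐ[ℝ] ℝ | χ (C X) < χ X} := by
    convert RealConstructible.pos (X - C X : R[X][X]) using 3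
    rw [map_sub, sub_pos]
  have hfree : RealConstructible {χ : R[X][X] →ₐ[ℝ] ℝ |
      RootFree (specialize χ (extendCoeffs (extendCoeffs F))) (Set.Ioo (χ (C X)) (χ X))} := by
    convert h.rootFree hF₂ ((RealConstructible.pos (X - C (C X) : R[X][X][X])).inter
      (RealConstructible.pos (C X - X : R[X][X][X]))) using 5
    ext w
    change _ ↔ 0 < evalAt _ w _ ∧ 0 < evalAt _ w _
    rw [map_sub, map_sub]
    simp
  convert h.hasLowerEndpoint hF
    (h.hasUpperEndpoint hF₁ ((hlt.inter hfree).inter hT)) using 1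
  ext φ
  simp only [HasRootFreeInterval, Set.mem_ofPred_eq, Set.mem_inter_iff, specialize_extendCoeffs,
    evalAt_X, evalAt_C]

end RootElimination

/-- Substitution of the midpoint of two variables. -/
def midpointHom (R : Type) [CommRing R] [Algebra ℝ R] : R[X] →ₐ[ℝ] R[X][X] :=
  (aeval (algebraMap ℝ R[X][X] 2⁻¹ * (C X + X)) : R[X] →ₐ[R] R[X][X]).restrictScalars ℝ

theorem evalAt_evalAt_comp_midpointHom (φ : R →ₐ[ℝ] ℝ) (u v : ℝ) :
    (evalAt (evalAt φ u) v).comp (midpointHom R) = evalAt φ ((u + v) / 2) := by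
  refine algHom_polynomial_ext (fun r => ?_) ?_
  · simp [midpointHom, Polynomial.algebraMap_apply]
  · simp only [midpointHom, AlgHom.comp_apply, AlgHom.restrictScalars_apply, aeval_X, map_mul,
      map_add, AlgHom.commutes, evalAt_C, evalAt_X]
    simp
    ring

theorem rootElimination_zero : RootElimination 0 := by
  intro R _ _ p hp S _
  convert RealConstructible.empty (R := R) using 1
  rw [Set.eq_empty_iff_forall_notMem]
  rintro φ ⟨h0, y, hy, _⟩
  rw [eq_C_of_natDegree_le_zero hp, map_C] at h0 hy
  rw [eval_C] at hy
  exact h0 (by rw [hy, C_0])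

theorem RootElimination.succ (h : RootElimination d) : RootElimination (d + 1) := by
  classical
  intro R _ _ p hp S hS
  set c := p.coeff (d + 1)
  have hq : (p - C c * X ^ (d + 1)).natDegree ≤ d := by
    refine natDegree_le_iff_coeff_eq_zero.mpr fun n hn => ?_
    rcases eq_or_ne n (d + 1) with rfl | hne
    · simp [c]
    · simp [coeff_X_pow, hne, coeff_eq_zero_of_natDegree_lt (show p.natDegree < n by omega)]
  obtain ⟨T, hTlow, hT⟩ := SignGenerated.exists_lowDegree hp hS
  obtain ⟨F₀, hF₀, hsign⟩ := hTlow.exists_finset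
  have hTc : RealConstructible T := hTlow.realConstructible
  set F := insert p.derivative F₀
  have hF : ∀ f ∈ F, f.natDegree ≤ d := by
    intro f hf
    rcases Finset.mem_insert.mp hf with rfl | hf
    · exact (natDegree_derivative_le p).trans (by omega)
    · exact hF₀ hf
  have hint := h.hasRootFreeInterval hF
    ((RealConstructible.pos (-(C p * p.map C) : R[X][X])).inter (hTc.comap (midpointHom R)))
  have hroot := h.exists_root hF ((RealConstructible.eq_zero p).inter hTc)
  convert ((RealConstructible.eq_zero c).inter (h R _ hq S hS)).union
    ((RealConstructible.ne_zero c).inter (hroot.union hint)) using 1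
  ext φ
  simp only [Set.mem_union, Set.mem_inter_iff, Set.mem_ofPred_eq]
  by_cases h0 : φ c = 0
  · simp [h0]
  have hp0 : p.map (φ : R →+* ℝ) ≠ 0 := fun h' => h0 (by simpa using congr_arg (coeff · (d + 1)) h')
  have hd0 : (p.map (φ : R →+* ℝ)).derivative ≠ 0 := by
    intro h'
    have := congr_arg (coeff · d) h'
    simp only [coeff_derivative, coeff_map, coeff_zero, mul_eq_zero] at this
    rcases this with h | h
    · exact h0 h
    · exact absurd h (by positivity)
  have hmem : (p.map (φ : R →+* ℝ)).derivative ∈ specialize φ F := by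
    rw [derivative_map]
    exact Finset.mem_image_of_mem _ (Finset.mem_insert_self _ _)
  have key := exists_root_iff_hasRootFreeInterval (s := fun y => evalAt φ y ∈ T) hmem hd0
    (by
      intro y z hyz
      refine hsign _ _ fun f hf => ?_
      simpa only [evalAt_apply] using
        forall_mem_specialize.mp hyz f (Finset.mem_insert_of_mem hf))
  have hST : (∃ y, (p.map (φ : R →+* ℝ)).eval y = 0 ∧ evalAt φ y ∈ S) ↔
      ∃ y, (p.map (φ : R →+* ℝ)).eval y = 0 ∧ evalAt φ y ∈ T :=
    exists_congr fun y => and_congr_right fun hy =>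
      hT _ (by simpa using h0) (by rw [evalAt_apply, hy])
  rw [hST, key]
  simp only [h0, hp0, false_and, false_or, true_and, not_false_eq_true, ne_eq,
    evalAt_evalAt_comp_midpointHom, map_neg, map_mul, evalAt_C, neg_pos]
  have hv : ∀ u v, evalAt (evalAt φ u) v (p.map C) = (p.map (φ : R →+* ℝ)).eval v := by
    intro u v
    rw [evalAt_apply, map_C_map_evalAt]
  simp only [hv, evalAt_apply]

theorem rootElimination (d : ℕ) : RootElimination d := by
  induction d with
  | zero => exact rootElimination_zero
  | succ d ih => exact ih.succ

/-- **Tarski–Seidenberg**: elimination of one real variable. -/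
theorem RealConstructible.exists_evalAt {S : Set (R[X] →ₐ[ℝ] ℝ)} (hS : RealConstructible S) :
    RealConstructible {φ : R →ₐ[ℝ] ℝ | ∃ y, evalAt φ y ∈ S} := by
  obtain ⟨F, -, hsign⟩ := SignGenerated.exists_finset hS
  have h := rootElimination (F.sup natDegree)
  have hF : ∀ f ∈ F, f.natDegree ≤ F.sup natDegree := fun f hf => Finset.le_sup hf
  convert (h.exists_root hF hS).union
    (h.hasRootFreeInterval hF (hS.comap (midpointHom R))) using 1
  ext φ
  simp only [Set.mem_union, Set.mem_ofPred_eq, evalAt_evalAt_comp_midpointHom]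
  refine exists_iff_hasRootFreeInterval (s := fun y => evalAt φ y ∈ S) fun y z hyz =>
    hsign _ _ fun f hf => ?_
  simpa only [evalAt_apply] using forall_mem_specialize.mp hyz f hf

end Elimination

/-! ### Semi-algebraic subsets of `ℝ^ι` -/

section Semialgebraic

variable {ι κ : Type} [Fintype ι] [Fintype κ] {S T : Set (ι → ℝ)}

theorem isBasicSemialgebraic_of_finite {α : Type} [Finite α] (p : MvPolynomial ι ℝ)
    (q : α → MvPolynomial ι ℝ) :
    IsBasicSemialgebraic
      {x | MvPolynomial.eval x p = 0 ∧ ∀ j, 0 < MvPolynomial.eval x (q j)} := by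
  obtain ⟨k, ⟨e⟩⟩ := Finite.exists_equiv_fin α
  refine ⟨p, k, q ∘ e.symm, ?_⟩
  ext x
  simp [e.symm.forall_congr_left]

theorem isSemialgebraic_iUnion_of_isBasic {α : Type} [Finite α] {T : α → Set (ι → ℝ)}
    (hT : ∀ i, IsBasicSemialgebraic (T i)) : IsSemialgebraic (⋃ i, T i) := by
  obtain ⟨k, ⟨e⟩⟩ := Finite.exists_equiv_fin α
  exact ⟨k, T ∘ e.symm, fun i => hT _, (e.symm.surjective.iUnion_comp T).symm⟩

theorem IsBasicSemialgebraic.isSemialgebraic (hS : IsBasicSemialgebraic S) :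
    IsSemialgebraic S := by
  simpa [Set.iUnion_const] using isSemialgebraic_iUnion_of_isBasic fun _ : Unit => hS

theorem IsBasicSemialgebraic.inter (hS : IsBasicSemialgebraic S) (hT : IsBasicSemialgebraic T) :
    IsBasicSemialgebraic (S ∩ T) := by
  obtain ⟨p, k, q, rfl⟩ := hS
  obtain ⟨p', k', q', rfl⟩ := hT
  convert isBasicSemialgebraic_of_finite (p ^ 2 + p' ^ 2) (Sum.elim q q') using 1
  ext x
  have h0 : MvPolynomial.eval x (p ^ 2 + p' ^ 2) = 0 ↔
      MvPolynomial.eval x p = 0 ∧ MvPolynomial.eval x p' = 0 := by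
    simp only [map_add, map_pow]
    rw [add_eq_zero_iff_of_nonneg (sq_nonneg _) (sq_nonneg _), sq_eq_zero_iff, sq_eq_zero_iff]
  simp only [Set.mem_inter_iff, Set.mem_ofPred_eq, h0, Sum.forall, Sum.elim_inl, Sum.elim_inr]
  tauto

theorem isSemialgebraic_pos (p : MvPolynomial ι ℝ) :
    IsSemialgebraic {x | 0 < MvPolynomial.eval x p} := by
  convert (isBasicSemialgebraic_of_finite 0 fun _ : Unit => p).isSemialgebraic using 1
  ext x
  simp

theorem isSemialgebraic_eq_zero (p : MvPolynomial ι ℝ) :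
    IsSemialgebraic {x | MvPolynomial.eval x p = 0} := by
  convert (isBasicSemialgebraic_of_finite p (Empty.elim)).isSemialgebraic using 1
  ext x
  simp

namespace IsSemialgebraic

theorem union (hS : IsSemialgebraic S) (hT : IsSemialgebraic T) : IsSemialgebraic (S ∪ T) := by
  obtain ⟨N, A, hA, rfl⟩ := hS
  obtain ⟨M, B, hB, rfl⟩ := hT
  have := isSemialgebraic_iUnion_of_isBasic (T := Sum.elim A B) (by simp [hA, hB])
  rwa [Set.iUnion_sum] at this

theorem inter (hS : IsSemialgebraic S) (hT : IsSemialgebraic T) : IsSemialgebraic (S ∩ T) := by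
  obtain ⟨N, A, hA, rfl⟩ := hS
  obtain ⟨M, B, hB, rfl⟩ := hT
  have := isSemialgebraic_iUnion_of_isBasic
    (T := fun i : Fin N × Fin M => A i.1 ∩ B i.2) fun i => (hA i.1).inter (hB i.2)
  convert this using 1
  ext x
  simp

theorem univ : IsSemialgebraic (Set.univ : Set (ι → ℝ)) := by
  simpa using isSemialgebraic_eq_zero (0 : MvPolynomial ι ℝ)

theorem empty : IsSemialgebraic (∅ : Set (ι → ℝ)) := by
  simpa using isSemialgebraic_pos (0 : MvPolynomial ι ℝ)

theorem iInter {α : Type} [Finite α] {T : α → Set (ι → ℝ)} (hT : ∀ i, IsSemialgebraic (T i)) :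
    IsSemialgebraic (⋂ i, T i) := by
  induction α using Finite.induction_empty_option with
  | of_equiv e ih =>
    rw [← e.surjective.iInter_comp]
    exact ih fun i => hT _
  | h_empty => simpa using univ
  | h_option ih =>
    rw [Set.iInter_option]
    exact (hT _).inter (ih fun i => hT _)

theorem iUnion {α : Type} [Finite α] {T : α → Set (ι → ℝ)} (hT : ∀ i, IsSemialgebraic (T i)) :
    IsSemialgebraic (⋃ i, T i) := by
  induction α using Finite.induction_empty_option with
  | of_equiv e ih =>
    rw [← e.surjective.iUnion_comp]
    exact ih fun i => hT _
  | h_empty => simpa using empty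
  | h_option ih =>
    rw [Set.iUnion_option]
    exact (hT _).union (ih fun i => hT _)

end IsSemialgebraic

theorem IsBasicSemialgebraic.compl (hS : IsBasicSemialgebraic S) : IsSemialgebraic Sᶜ := by
  obtain ⟨p, k, q, rfl⟩ := hS
  convert ((isSemialgebraic_pos p).union (isSemialgebraic_pos (-p))).union
    (IsSemialgebraic.iUnion fun j =>
      (isSemialgebraic_pos (-q j)).union (isSemialgebraic_eq_zero (q j))) using 1
  ext x
  simp only [Set.mem_compl_iff, Set.mem_ofPred_eq, not_and_or, not_forall, not_lt, Set.mem_union,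
    Set.mem_iUnion, map_neg, neg_pos, ← le_iff_lt_or_eq]
  exact or_congr_left (ne_iff_lt_or_gt.trans or_comm)

theorem IsSemialgebraic.compl (hS : IsSemialgebraic S) : IsSemialgebraic Sᶜ := by
  obtain ⟨N, A, hA, rfl⟩ := hS
  rw [Set.compl_iUnion]
  exact .iInter fun i => (hA i).compl

/-- The set of real points of the polynomial ring corresponding to a subset of `ℝ^ι`. -/
def pointSet (S : Set (ι → ℝ)) : Set (MvPolynomial ι ℝ →ₐ[ℝ] ℝ) :=
  {φ | (fun i => φ (MvPolynomial.X i)) ∈ S}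

theorem eval_comp_X {σ : Type} (φ : MvPolynomial σ ℝ →ₐ[ℝ] ℝ) (p : MvPolynomial σ ℝ) :
    MvPolynomial.eval (fun i => φ (MvPolynomial.X i)) p = φ p := by
  rw [← MvPolynomial.coe_aeval_eq_eval, RingHom.coe_coe]
  congr 1
  ext i
  simp

theorem IsSemialgebraic.realConstructible_pointSet (hS : IsSemialgebraic S) :
    RealConstructible (pointSet S) := by
  obtain ⟨N, A, hA, rfl⟩ := hS
  choose p k q h using hA
  convert RealConstructible.biUnion Finset.univ fun i _ =>
    (RealConstructible.eq_zero (p i)).inter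
      (RealConstructible.biInter Finset.univ fun j _ => RealConstructible.pos (q i j)) using 1
  ext φ
  simp [pointSet, h, eval_comp_X]

theorem RealConstructible.isSemialgebraic {A : Set (MvPolynomial ι ℝ →ₐ[ℝ] ℝ)}
    (hA : RealConstructible A) : IsSemialgebraic {x | MvPolynomial.aeval x ∈ A} := by
  induction hA with
  | @pos r _ => simpa [MvPolynomial.aeval_eq_eval] using isSemialgebraic_pos r
  | compl _ ih => exact ih.compl
  | inter _ _ ih₁ ih₂ => exact ih₁.inter ih₂

namespace IsSemialgebraic

theorem comap (f : ι → κ) (hS : IsSemialgebraic S) : IsSemialgebraic {x : κ → ℝ | x ∘ f ∈ S} := by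
  convert (hS.realConstructible_pointSet.comap (MvPolynomial.rename f)).isSemialgebraic using 1
  ext x
  simp [pointSet, Function.comp_def]

theorem exists_option {S : Set (Option ι → ℝ)} (hS : IsSemialgebraic S) :
    IsSemialgebraic {x : ι → ℝ | ∃ t, (fun o => Option.elim o t x) ∈ S} := by
  convert (hS.realConstructible_pointSet.comap
    (MvPolynomial.optionEquivLeft ℝ ι).toAlgHom).exists_evalAt.isSemialgebraic using 1
  ext x
  refine exists_congr fun t => ?_
  simp only [pointSet, Set.mem_ofPred_eq]
  apply iff_of_eq
  congr 1
  funext o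
  cases o <;> simp

theorem exists_fin {m : ℕ} {S : Set (ι ⊕ Fin m → ℝ)} (hS : IsSemialgebraic S) :
    IsSemialgebraic {x : ι → ℝ | ∃ y : Fin m → ℝ, Sum.elim x y ∈ S} := by
  induction m with
  | zero =>
    convert hS.comap (Sum.elim id Fin.elim0) using 1
    ext x
    simp only [Set.mem_ofPred_eq, Fin.exists_fin_zero_pi]
    apply iff_of_eq
    congr 1
    ext (i | i)
    · rfl
    · exact i.elim0
  | succ m ih =>
    convert ih (hS.comap
      (Sum.elim (some ∘ Sum.inl) (Fin.cases none (some ∘ Sum.inr)) :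
        ι ⊕ Fin (m + 1) → Option (ι ⊕ Fin m))).exists_option using 1
    ext x
    simp only [Set.mem_ofPred_eq, Fin.exists_fin_succ_pi]
    rw [exists_comm]
    refine exists_congr fun y => exists_congr fun t => ?_
    apply iff_of_eq
    congr 1
    ext (i | i)
    · rfl
    · cases i using Fin.cases <;> rfl

theorem forall_fin {m : ℕ} {S : Set (ι ⊕ Fin m → ℝ)} (hS : IsSemialgebraic S) :
    IsSemialgebraic {x : ι → ℝ | ∀ y : Fin m → ℝ, Sum.elim x y ∈ S} := by
  convert hS.compl.exists_fin.compl using 1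
  ext x
  simp

theorem exists_unit {S : Set (ι ⊕ Unit → ℝ)} (hS : IsSemialgebraic S) :
    IsSemialgebraic {x : ι → ℝ | ∃ t : ℝ, Sum.elim x (fun _ => t) ∈ S} := by
  convert (hS.comap (Sum.elim some fun _ => none : ι ⊕ Unit → Option ι)).exists_option using 1
  ext x
  refine exists_congr fun t => ?_
  simp only [Set.mem_ofPred_eq]
  apply iff_of_eq
  congr 1
  ext (i | i) <;> rfl

theorem forall_unit {S : Set (ι ⊕ Unit → ℝ)} (hS : IsSemialgebraic S) :
    IsSemialgebraic {x : ι → ℝ | ∀ t : ℝ, Sum.elim x (fun _ => t) ∈ S} := by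
  convert hS.compl.exists_unit.compl using 1
  ext x
  simp

end IsSemialgebraic

end Semialgebraic

/-! ### Value functions -/

section ValueFunctions

variable {ι : Type} [Fintype ι]

theorem isSemialgebraic_le (p q : MvPolynomial ι ℝ) :
    IsSemialgebraic {x | MvPolynomial.eval x p ≤ MvPolynomial.eval x q} := by
  convert (isSemialgebraic_pos (p - q)).compl using 1
  ext x
  simp

theorem IsSemialgebraic.imp {S T : Set (ι → ℝ)} (hS : IsSemialgebraic S)
    (hT : IsSemialgebraic T) : IsSemialgebraic {x | x ∈ S → x ∈ T} := by
  convert hS.compl.union hT using 1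
  ext x
  simp [imp_iff_not_or]

theorem isERealSemialgebraicFun_of_le {h : (ι → ℝ) → EReal}
    (hh : IsSemialgebraic {z : ι ⊕ Unit → ℝ | (z (Sum.inr ()) : EReal) ≤ h (z ∘ Sum.inl)}) :
    IsERealSemialgebraicFun h := by
  have htop : IsSemialgebraic {x | h x = ⊤} := by
    convert hh.forall_unit using 1
    ext x
    simp only [Set.mem_ofPred_eq, Sum.elim_inr, Sum.elim_comp_inl]
    refine ⟨fun hx t => hx ▸ le_top, fun hx => EReal.eq_top_iff_forall_lt _ |>.mpr fun t => ?_⟩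
    exact (EReal.coe_lt_coe_iff.mpr (lt_add_one t)).trans_le (hx (t + 1))
  have hbot : IsSemialgebraic {x | h x = ⊥} := by
    convert hh.compl.forall_unit using 1
    ext x
    simp only [Set.mem_ofPred_eq, Set.mem_compl_iff, Sum.elim_inr, Sum.elim_comp_inl, not_le]
    exact EReal.eq_bot_iff_forall_lt _
  refine ⟨?_, htop, hbot, ?_⟩
  · convert (htop.union hbot).compl using 1
    ext x
    simp only [Set.mem_ofPred_eq, Set.mem_compl_iff, Set.mem_union]
    induction h x <;> simp
  · have hle : IsSemialgebraic {z : (ι ⊕ Unit) ⊕ Unit → ℝ |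
        z (Sum.inr ()) ≤ z (Sum.inl (Sum.inr ()))} := by
      simpa using isSemialgebraic_le (MvPolynomial.X (Sum.inr ()))
        (MvPolynomial.X (Sum.inl (Sum.inr ())) : MvPolynomial ((ι ⊕ Unit) ⊕ Unit) ℝ)
    convert hh.inter ((hh.comap (Sum.elim (Sum.inl ∘ Sum.inl) Sum.inr :
      ι ⊕ Unit → (ι ⊕ Unit) ⊕ Unit)).imp hle).forall_unit using 1
    ext z
    simp only [Set.mem_ofPred_eq, Set.mem_inter_iff, Sum.elim_inr, Sum.elim_inl,
      Function.comp_def]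
    refine ⟨fun hz => ⟨hz.ge, fun t ht => EReal.coe_le_coe_iff.mp (ht.trans hz.le)⟩, fun hz => ?_⟩
    refine le_antisymm (not_lt.mp fun hlt => ?_) hz.1
    obtain ⟨t, h₁, h₂⟩ := EReal.lt_iff_exists_real_btwn.mp hlt
    exact absurd (hz.2 t h₂.le) (not_le.mpr (EReal.coe_lt_coe_iff.mp h₁))

theorem isERealSemialgebraicFun_of_lt {h : (ι → ℝ) → EReal}
    (hh : IsSemialgebraic {z : ι ⊕ Unit → ℝ | (z (Sum.inr ()) : EReal) < h (z ∘ Sum.inl)}) :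
    IsERealSemialgebraicFun h := by
  refine isERealSemialgebraicFun_of_le ?_
  have hlt : IsSemialgebraic {z : (ι ⊕ Unit) ⊕ Unit → ℝ |
      z (Sum.inl (Sum.inr ())) ≤ z (Sum.inr ())}ᶜ := by
    simpa using (isSemialgebraic_le (MvPolynomial.X (Sum.inl (Sum.inr ())))
      (MvPolynomial.X (Sum.inr ()) : MvPolynomial ((ι ⊕ Unit) ⊕ Unit) ℝ)).compl
  convert (hlt.imp (hh.comap (Sum.elim (Sum.inl ∘ Sum.inl) Sum.inr :
    ι ⊕ Unit → (ι ⊕ Unit) ⊕ Unit))).forall_unit using 1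
  ext z
  simp only [Set.mem_ofPred_eq, Set.mem_compl_iff, not_le, Sum.elim_inr, Sum.elim_inl,
    Function.comp_def]
  refine ⟨fun hz t ht => (EReal.coe_lt_coe_iff.mpr ht).trans_le hz, fun hz =>
    not_lt.mp fun hlt => ?_⟩
  obtain ⟨t, h₁, h₂⟩ := EReal.lt_iff_exists_real_btwn.mp hlt
  exact absurd (hz t (EReal.coe_lt_coe_iff.mp h₂)) h₁.not_gt

theorem IsBox.isSemialgebraic {m : ℕ} {Y : Set (Fin m → ℝ)} (hY : IsBox Y) :
    IsSemialgebraic Y := by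
  obtain ⟨a, b, rfl⟩ := hY
  have hlow : ∀ (c : EReal) (i : Fin m), IsSemialgebraic {y : Fin m → ℝ | c ≤ (y i : EReal)} := by
    intro c i
    induction c with
    | bot => simpa using IsSemialgebraic.univ
    | coe c => simpa using isSemialgebraic_le (MvPolynomial.C c) (MvPolynomial.X i)
    | top => simpa using IsSemialgebraic.empty
  have hupp : ∀ (c : EReal) (i : Fin m), IsSemialgebraic {y : Fin m → ℝ | (y i : EReal) ≤ c} := by
    intro c i
    induction c with
    | bot => simpa using IsSemialgebraic.empty
    | coe c => simpa using isSemialgebraic_le (MvPolynomial.X i) (MvPolynomial.C c)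
    | top => simpa using IsSemialgebraic.univ
  convert IsSemialgebraic.iInter fun i => (hlow (a i) i).inter (hupp (b i) i) using 1
  ext y
  simp

variable {n m : ℕ} {P Q : (Fin n → ℝ) → (Fin m → ℝ) → ℝ} {Y : Set (Fin m → ℝ)}

theorem isSemialgebraic_argminSet (hQ : IsPolyMap Q) (hY : IsSemialgebraic Y) :
    IsSemialgebraic {z : Fin n ⊕ Fin m → ℝ |
      z ∘ Sum.inr ∈ argminSet Q Y (z ∘ Sum.inl)} := by
  obtain ⟨q, hq⟩ := hQ
  have hle := isSemialgebraic_le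
    (MvPolynomial.rename (Sum.inl : Fin n ⊕ Fin m → (Fin n ⊕ Fin m) ⊕ Fin m) q)
    (MvPolynomial.rename (Sum.elim (Sum.inl ∘ Sum.inl) Sum.inr) q)
  convert (hY.comap Sum.inr).inter ((hY.comap Sum.inr).imp hle).forall_fin using 1
  ext z
  simp [argminSet, hq, MvPolynomial.eval_rename, Sum.comp_elim, ← Function.comp_assoc]

theorem isERealSemialgebraicFun_valOpt (hP : IsPolyMap P) (hQ : IsPolyMap Q)
    (hY : IsSemialgebraic Y) : IsERealSemialgebraicFun (valOpt P Q Y) := by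
  refine isERealSemialgebraicFun_of_le ?_
  have harg := isSemialgebraic_argminSet hQ hY
  obtain ⟨p, hp⟩ := hP
  have hle := isSemialgebraic_le
    (MvPolynomial.X (Sum.inl (Sum.inr ())) : MvPolynomial ((Fin n ⊕ Unit) ⊕ Fin m) ℝ)
    (MvPolynomial.rename (Sum.elim (Sum.inl ∘ Sum.inl) Sum.inr) p)
  convert ((harg.comap (Sum.elim (Sum.inl ∘ Sum.inl) Sum.inr :
    Fin n ⊕ Fin m → (Fin n ⊕ Unit) ⊕ Fin m)).imp hle).forall_fin using 1
  ext z
  have hz : ∀ y : Fin m → ℝ, Sum.elim z y ∘ Sum.elim (Sum.inl ∘ Sum.inl) Sum.inr =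
      Sum.elim (z ∘ Sum.inl) y := fun y => by
    ext (i | i) <;> rfl
  simp [valOpt, hp, MvPolynomial.eval_rename, hz]

theorem isERealSemialgebraicFun_valPess (hP : IsPolyMap P) (hQ : IsPolyMap Q)
    (hY : IsSemialgebraic Y) : IsERealSemialgebraicFun (valPess P Q Y) := by
  refine isERealSemialgebraicFun_of_lt ?_
  have harg := isSemialgebraic_argminSet hQ hY
  obtain ⟨p, hp⟩ := hP
  have hlt := (isSemialgebraic_le
    (MvPolynomial.rename (Sum.elim (Sum.inl ∘ Sum.inl) Sum.inr) p)
    (MvPolynomial.X (Sum.inl (Sum.inr ())) : MvPolynomial ((Fin n ⊕ Unit) ⊕ Fin m) ℝ)).compl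
  convert ((harg.comap (Sum.elim (Sum.inl ∘ Sum.inl) Sum.inr :
    Fin n ⊕ Fin m → (Fin n ⊕ Unit) ⊕ Fin m)).inter hlt).exists_fin using 1
  ext z
  have hz : ∀ y : Fin m → ℝ, Sum.elim z y ∘ Sum.elim (Sum.inl ∘ Sum.inl) Sum.inr =
      Sum.elim (z ∘ Sum.inl) y := fun y => by
    ext (i | i) <;> rfl
  simp [valPess, hp, MvPolynomial.eval_rename, hz, lt_iSup_iff]

end ValueFunctions

/-- for polynomial `P, Q` and a box `𝒴`, the optimistic and pessimistic value
functions are extended-real-valued semi-algebraic functions. -/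
theorem value_functions_semialgebraic (n m : ℕ)
    (P Q : (Fin n → ℝ) → (Fin m → ℝ) → ℝ)
    (hP : IsPolyMap P) (hQ : IsPolyMap Q)
    (Y : Set (Fin m → ℝ)) (hY : IsBox Y) :
    IsERealSemialgebraicFun (valOpt P Q Y) ∧
    IsERealSemialgebraicFun (valPess P Q Y) := by
  exact ⟨isERealSemialgebraicFun_valOpt hP hQ hY.isSemialgebraic,
    isERealSemialgebraicFun_valPess hP hQ hY.isSemialgebraic⟩
end
end

section
/- Let f : ℝⁿ → ℝ be a real-valued function that is semi-algebraic, lower semicontinuous, and bounded on every compact subset of ℝⁿ. Then there exist m ∈ ℕ, polynomials P, Q : ℝⁿ × ℝᵐ → ℝ, and a bounded box 𝒴 = [a₁,b₁] × … × [aₘ,bₘ] ⊆ ℝᵐ (all aᵢ, bᵢ real) such that the optimistic value function φ_o of the associated bilevel problem satisfies φ_o = f. -/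
open Set

noncomputable section

open Polynomial

/-! ### Sets described by sign conditions on an algebra of functions -/

/-- The sets described by finitely many sign conditions on functions of the algebra `A`. -/
inductive SignSet {X : Type} (A : Subalgebra ℝ (X → ℝ)) : Set X → Prop
  | basic (p : X → ℝ) (hp : p ∈ A) (L : List (X → ℝ)) (hL : ∀ q ∈ L, q ∈ A) :
      SignSet A {x | p x = 0 ∧ ∀ q ∈ L, 0 < q x}
  | union {S T : Set X} : SignSet A S → SignSet A T → SignSet A (S ∪ T)

/-- Composition with `φ`, as a morphism of function algebras. -/
def pullback {X Y : Type} (φ : X → Y) : (Y → ℝ) →ₐ[ℝ] (X → ℝ) where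
  toFun g := fun x => g (φ x)
  map_one' := rfl
  map_mul' _ _ := rfl
  map_zero' := rfl
  map_add' _ _ := rfl
  commutes' _ := rfl

/-- The algebra of functions on `X × Y` generated by `A` and `B`. -/
def prodAlg {X Y : Type} (A : Subalgebra ℝ (X → ℝ)) (B : Subalgebra ℝ (Y → ℝ)) :
    Subalgebra ℝ (X × Y → ℝ) :=
  A.map (pullback Prod.fst) ⊔ B.map (pullback Prod.snd)

/-- The algebra of polynomial functions on the real line. -/
def lineAlg : Subalgebra ℝ (ℝ → ℝ) := Algebra.adjoin ℝ {fun t => t}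

/-- The algebra of polynomial functions on `ι → ℝ`. -/
def coordAlg (ι : Type) : Subalgebra ℝ ((ι → ℝ) → ℝ) :=
  Algebra.adjoin ℝ (Set.range fun i x => x i)

section Algebras

variable {X Y Z : Type} {A : Subalgebra ℝ (X → ℝ)} {B : Subalgebra ℝ (Y → ℝ)}
  {C : Subalgebra ℝ (Z → ℝ)}

lemma const_mem (c : ℝ) : (fun _ : X => c) ∈ A := A.algebraMap_mem c

lemma comp_fst_mem {a : X → ℝ} (ha : a ∈ A) : (fun z : X × Y => a z.1) ∈ prodAlg A B :=
  (le_sup_left : _ ≤ prodAlg A B) ⟨a, ha, rfl⟩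

lemma comp_snd_mem {b : Y → ℝ} (hb : b ∈ B) : (fun z : X × Y => b z.2) ∈ prodAlg A B :=
  (le_sup_right : _ ≤ prodAlg A B) ⟨b, hb, rfl⟩

lemma id_mem_lineAlg : (fun t : ℝ => t) ∈ lineAlg := Algebra.subset_adjoin rfl

lemma coord_mem_coordAlg {ι : Type} (i : ι) : (fun x : ι → ℝ => x i) ∈ coordAlg ι :=
  Algebra.subset_adjoin ⟨i, rfl⟩

lemma snd_mem : (fun z : X × ℝ => z.2) ∈ prodAlg A lineAlg := comp_snd_mem id_mem_lineAlg

lemma prodAlg_le_comap {φ : Z → X × Y}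
    (h₁ : A ≤ C.comap (pullback fun z => (φ z).1)) (h₂ : B ≤ C.comap (pullback fun z => (φ z).2)) :
    prodAlg A B ≤ C.comap (pullback φ) := by
  refine sup_le ?_ ?_
  · rintro _ ⟨a, ha, rfl⟩
    exact h₁ ha
  · rintro _ ⟨a, ha, rfl⟩
    exact h₂ ha

lemma lineAlg_le_comap {φ : Z → ℝ} (h : φ ∈ C) : lineAlg ≤ C.comap (pullback φ) := by
  refine Algebra.adjoin_le ?_
  rintro _ rfl
  exact h

lemma coordAlg_le_comap {ι : Type} {φ : Z → ι → ℝ} (h : ∀ i, (fun z => φ z i) ∈ C) :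
    coordAlg ι ≤ C.comap (pullback φ) := by
  refine Algebra.adjoin_le ?_
  rintro _ ⟨i, rfl⟩
  exact h i

lemma le_comap_fst : A ≤ (prodAlg A B).comap (pullback Prod.fst) := fun _ h => comp_fst_mem h

lemma le_comap_snd : B ≤ (prodAlg A B).comap (pullback Prod.snd) := fun _ h => comp_snd_mem h

lemma comap_trans (φ : X → Y) (ψ : Y → Z) (h₁ : B ≤ A.comap (pullback φ))
    (h₂ : C ≤ B.comap (pullback ψ)) : C ≤ A.comap (pullback fun x => ψ (φ x)) :=
  fun _ h => h₁ (h₂ h)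

lemma sum_mem' {ι : Type} (s : Finset ι) {F : ι → X → ℝ} (h : ∀ i ∈ s, F i ∈ A) :
    (fun x => ∑ i ∈ s, F i x) ∈ A := by
  have := A.sum_mem h
  convert this using 1
  ext x
  simp

lemma add_mem' {a b : X → ℝ} (ha : a ∈ A) (hb : b ∈ A) : (fun x => a x + b x) ∈ A :=
  A.add_mem ha hb

lemma sub_mem' {a b : X → ℝ} (ha : a ∈ A) (hb : b ∈ A) : (fun x => a x - b x) ∈ A :=
  A.sub_mem ha hb

lemma neg_mem' {a : X → ℝ} (ha : a ∈ A) : (fun x => -a x) ∈ A := A.neg_mem ha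

lemma mul_mem' {a b : X → ℝ} (ha : a ∈ A) (hb : b ∈ A) : (fun x => a x * b x) ∈ A :=
  A.mul_mem ha hb

lemma pow_mem' {a : X → ℝ} (ha : a ∈ A) (k : ℕ) : (fun x => a x ^ k) ∈ A := A.pow_mem ha k

end Algebras

namespace SignSet

variable {X Y : Type} {A : Subalgebra ℝ (X → ℝ)} {B : Subalgebra ℝ (Y → ℝ)} {S T : Set X}

lemma eq_zero {p : X → ℝ} (hp : p ∈ A) : SignSet A {x | p x = 0} := by
  simpa using SignSet.basic p hp [] (by simp)

lemma pos {p : X → ℝ} (hp : p ∈ A) : SignSet A {x | 0 < p x} := by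
  simpa using SignSet.basic (A := A) 0 A.zero_mem [p] (by simpa using hp)

lemma univ : SignSet A Set.univ := by
  simpa using eq_zero (A := A) A.zero_mem

lemma empty : SignSet A ∅ := by
  simpa using pos (A := A) A.zero_mem

lemma or {p q : X → Prop} (hp : SignSet A {x | p x}) (hq : SignSet A {x | q x}) :
    SignSet A {x | p x ∨ q x} := hp.union hq

lemma inter (hS : SignSet A S) (hT : SignSet A T) : SignSet A (S ∩ T) := by
  induction hS with
  | union h₁ h₂ i₁ i₂ => rw [Set.union_inter_distrib_right]; exact i₁.union i₂
  | basic p hp L hL =>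
    induction hT with
    | union h₁ h₂ i₁ i₂ => rw [Set.inter_union_distrib_left]; exact i₁.union i₂
    | basic p' hp' L' hL' =>
      convert SignSet.basic (A := A) (fun x => p x ^ 2 + p' x ^ 2)
        (add_mem' (pow_mem' hp 2) (pow_mem' hp' 2)) (L ++ L')
        (by intro q hq; rcases List.mem_append.1 hq with h | h; exacts [hL q h, hL' q h]) using 1
      ext x
      simp only [Set.mem_inter_iff, Set.mem_ofPred_eq, List.mem_append]
      constructor
      · rintro ⟨⟨h₁, h₂⟩, h₃, h₄⟩
        refine ⟨by simp [h₁, h₃], ?_⟩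
        rintro q (h | h)
        exacts [h₂ q h, h₄ q h]
      · rintro ⟨h₁, h₂⟩
        have e₁ : p x = 0 := by nlinarith [sq_nonneg (p x), sq_nonneg (p' x)]
        have e₂ : p' x = 0 := by nlinarith [sq_nonneg (p x), sq_nonneg (p' x)]
        exact ⟨⟨e₁, fun q h => h₂ q (Or.inl h)⟩, e₂, fun q h => h₂ q (Or.inr h)⟩

lemma and {p q : X → Prop} (hp : SignSet A {x | p x}) (hq : SignSet A {x | q x}) :
    SignSet A {x | p x ∧ q x} := hp.inter hq

lemma ne_zero {p : X → ℝ} (hp : p ∈ A) : SignSet A {x | p x ≠ 0} := by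
  convert (pos hp).or (pos (neg_mem' hp)) using 1
  ext x
  simp [lt_or_lt_iff_ne, or_comm]

lemma nonpos {p : X → ℝ} (hp : p ∈ A) : SignSet A {x | p x ≤ 0} := by
  convert (eq_zero hp).or (pos (neg_mem' hp)) using 1
  ext x
  simp [le_iff_eq_or_lt]

lemma lt {p q : X → ℝ} (hp : p ∈ A) (hq : q ∈ A) : SignSet A {x | p x < q x} := by
  simpa using pos (sub_mem' hq hp)

lemma le {p q : X → ℝ} (hp : p ∈ A) (hq : q ∈ A) : SignSet A {x | p x ≤ q x} := by
  simpa using nonpos (sub_mem' hp hq)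

lemma eq {p q : X → ℝ} (hp : p ∈ A) (hq : q ∈ A) : SignSet A {x | p x = q x} := by
  simpa [sub_eq_zero] using eq_zero (sub_mem' hp hq)

lemma list_exists {α : Type} {p : α → X → Prop} (L : List α)
    (h : ∀ a ∈ L, SignSet A {x | p a x}) : SignSet A {x | ∃ a ∈ L, p a x} := by
  induction L with
  | nil => simpa using empty
  | cons a L ih =>
    simp only [List.mem_cons, exists_eq_or_imp]
    exact (h a (by simp)).or (ih fun b hb => h b (by simp [hb]))

lemma list_forall {α : Type} {p : α → X → Prop} (L : List α)
    (h : ∀ a ∈ L, SignSet A {x | p a x}) : SignSet A {x | ∀ a ∈ L, p a x} := by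
  induction L with
  | nil => simpa using univ
  | cons a L ih =>
    simp only [List.mem_cons, forall_eq_or_imp]
    exact (h a (by simp)).and (ih fun b hb => h b (by simp [hb]))

lemma compl (hS : SignSet A S) : SignSet A Sᶜ := by
  induction hS with
  | union h₁ h₂ i₁ i₂ => rw [Set.compl_union]; exact i₁.inter i₂
  | basic p hp L hL =>
    convert (ne_zero hp).or (list_exists L fun q hq => nonpos (hL q hq)) using 1
    ext x
    simp [imp_iff_not_or]

lemma not {p : X → Prop} (hp : SignSet A {x | p x}) : SignSet A {x | ¬ p x} := hp.compl

lemma preimage {φ : X → Y} {U : Set Y} (hU : SignSet B U) (h : B ≤ A.comap (pullback φ)) :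
    SignSet A (φ ⁻¹' U) := by
  induction hU with
  | union h₁ h₂ i₁ i₂ => exact i₁.union i₂
  | basic p hp L hL =>
    exact (eq_zero (A := A) (h hp)).and (list_forall L fun q hq => pos (h (hL q hq)))

end SignSet

/-! ### Families of univariate polynomials -/

/-- A family of univariate polynomials of degree at most `d` whose coefficients belong to `A`. -/
structure IsFamily {X : Type} (A : Subalgebra ℝ (X → ℝ)) (d : ℕ) (P : X → ℝ[X]) : Prop where
  coeff_mem : ∀ i, (fun x => (P x).coeff i) ∈ A
  natDegree_le : ∀ x, (P x).natDegree ≤ d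

namespace IsFamily

variable {X Y : Type} {A : Subalgebra ℝ (X → ℝ)} {B : Subalgebra ℝ (Y → ℝ)} {d e : ℕ}
  {P Q : X → ℝ[X]}

lemma mono (h : IsFamily A d P) (hd : d ≤ e) : IsFamily A e P :=
  ⟨h.1, fun x => (h.2 x).trans hd⟩

lemma add (hP : IsFamily A d P) (hQ : IsFamily A e Q) :
    IsFamily A (max d e) (fun x => P x + Q x) :=
  ⟨fun i => by simpa using add_mem' (hP.1 i) (hQ.1 i), fun x =>
    (natDegree_add_le _ _).trans (max_le_max (hP.2 x) (hQ.2 x))⟩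

lemma neg (hP : IsFamily A d P) : IsFamily A d (fun x => -P x) :=
  ⟨fun i => by simpa using neg_mem' (hP.1 i), fun x => by simpa using hP.2 x⟩

lemma mul (hP : IsFamily A d P) (hQ : IsFamily A e Q) :
    IsFamily A (d + e) (fun x => P x * Q x) := by
  refine ⟨fun i => ?_, fun x => natDegree_mul_le.trans (add_le_add (hP.2 x) (hQ.2 x))⟩
  simp only [coeff_mul]
  exact sum_mem' _ fun j _ => mul_mem' (hP.1 _) (hQ.1 _)

lemma monomial {a : X → ℝ} (ha : a ∈ A) (k : ℕ) :
    IsFamily A k (fun x => Polynomial.monomial k (a x)) := by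
  refine ⟨fun i => ?_, fun x => natDegree_monomial_le _⟩
  simp only [coeff_monomial]
  split_ifs
  exacts [ha, A.zero_mem]

lemma const {a : X → ℝ} (ha : a ∈ A) : IsFamily A 0 (fun x => C (a x)) := by
  simpa using monomial ha 0

lemma derivative (hP : IsFamily A (d + 1) P) :
    IsFamily A d (fun x => Polynomial.derivative (P x)) := by
  refine ⟨fun i => ?_, fun x => (natDegree_derivative_le _).trans ?_⟩
  · simp only [coeff_derivative]
    exact mul_mem' (hP.1 _) (const_mem _)
  · have := hP.2 x
    omega

lemma comp {φ : Y → X} (hP : IsFamily A d P) (h : A ≤ B.comap (pullback φ)) :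
    IsFamily B d (fun y => P (φ y)) :=
  ⟨fun i => h (hP.1 i), fun _ => hP.2 _⟩

lemma eval_mem (hP : IsFamily A d P) :
    (fun z : X × ℝ => (P z.1).eval z.2) ∈ prodAlg A lineAlg := by
  have : (fun z : X × ℝ => (P z.1).eval z.2)
      = fun z => ∑ i ∈ Finset.range (d + 1), (P z.1).coeff i * z.2 ^ i := by
    ext z
    exact eval_eq_sum_range' (Nat.lt_succ_of_le (hP.2 _)) _
  rw [this]
  exact sum_mem' _ fun i _ => mul_mem' (comp_fst_mem (hP.1 i)) (pow_mem' snd_mem i)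

lemma signSet_ne_zero (hP : IsFamily A d P) : SignSet A {x | P x ≠ 0} := by
  convert SignSet.list_exists (List.range (d + 1)) fun i _ => SignSet.ne_zero (hP.1 i) using 1
  ext x
  simp only [Set.mem_ofPred_eq, List.mem_range]
  constructor
  · intro h
    refine ⟨(P x).natDegree, Nat.lt_succ_of_le (hP.2 x), ?_⟩
    simpa using h
  · rintro ⟨i, -, hi⟩ h
    simp [h] at hi

end IsFamily

lemma exists_family_of_mem {X : Type} {A : Subalgebra ℝ (X → ℝ)} {F : X × ℝ → ℝ}
    (hF : F ∈ prodAlg A lineAlg) :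
    ∃ d P, IsFamily A d P ∧ ∀ x t, F (x, t) = (P x).eval t := by
  let R : Subalgebra ℝ (X × ℝ → ℝ) :=
    { carrier := {F | ∃ d P, IsFamily A d P ∧ ∀ x t, F (x, t) = (P x).eval t}
      mul_mem' := by
        rintro F G ⟨d, P, hP, h⟩ ⟨e, Q, hQ, h'⟩
        exact ⟨_, _, hP.mul hQ, fun x t => by simp [h, h']⟩
      add_mem' := by
        rintro F G ⟨d, P, hP, h⟩ ⟨e, Q, hQ, h'⟩
        exact ⟨_, _, hP.add hQ, fun x t => by simp [h, h']⟩
      algebraMap_mem' := fun c => ⟨_, _, IsFamily.const (const_mem c), fun x t => by simp⟩ }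
  have : prodAlg A lineAlg ≤ R := by
    refine sup_le ?_ ?_
    · rintro _ ⟨a, ha, rfl⟩
      exact ⟨_, _, IsFamily.const ha, fun x t => by simp; rfl⟩
    · rw [Subalgebra.map_le]
      refine lineAlg_le_comap (C := R) ?_
      exact ⟨_, _, IsFamily.monomial (const_mem 1) 1, fun x t => by simp⟩
  exact this hF

/-! ### Real univariate polynomials between consecutive roots -/

lemma eval_pos_of_forall_ne_zero {R : ℝ[X]} {I : Set ℝ} (hI : I.OrdConnected)
    (h : ∀ w ∈ I, R.eval w ≠ 0) {u v : ℝ} (hu : u ∈ I) (hv : v ∈ I) (hR : 0 < R.eval u) :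
    0 < R.eval v := by
  by_contra! hle
  obtain ⟨w, hw, hw'⟩ := hI.isPreconnected.intermediate_value hv hu
    R.continuous.continuousOn ⟨hle, hR.le⟩
  exact h w hw hw'

lemma finite_roots_list {L : List ℝ[X]} (h : ∀ R ∈ L, R ≠ 0) :
    {γ | ∃ R ∈ L, R.eval γ = 0}.Finite := by
  have hW : L.prod ≠ 0 := by
    rw [Ne, List.prod_eq_zero_iff]
    exact fun h0 => h 0 h0 rfl
  refine (L.prod.rootSet_finite ℝ).subset ?_
  rintro γ ⟨R, hR, hγ⟩
  rw [mem_rootSet]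
  refine ⟨hW, ?_⟩
  obtain ⟨S, hS⟩ := List.dvd_prod hR
  simp [hS, hγ]

lemma exists_greatest_root {L : List ℝ[X]} (h : ∀ R ∈ L, R ≠ 0) {t : ℝ}
    (ht : ∃ R ∈ L, ∃ α < t, R.eval α = 0) :
    ∃ R ∈ L, ∃ α < t, R.eval α = 0 ∧ ∀ S ∈ L, ∀ γ, α < γ → γ < t → S.eval γ ≠ 0 := by
  obtain ⟨R, hR, α, hα, h0⟩ := ht
  obtain ⟨m, ⟨⟨T, hT, hm⟩, hmt⟩, hmax⟩ := Set.exists_max_image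
    ({γ | ∃ R ∈ L, R.eval γ = 0} ∩ Set.Iio t) id ((finite_roots_list h).inter_of_left _)
    ⟨α, ⟨R, hR, h0⟩, hα⟩
  exact ⟨T, hT, m, hmt, hm, fun S hS γ h₁ h₂ h₃ =>
    absurd (hmax γ ⟨⟨S, hS, h₃⟩, h₂⟩) (not_le.2 h₁)⟩

lemma exists_least_root {L : List ℝ[X]} (h : ∀ R ∈ L, R ≠ 0) {t : ℝ}
    (ht : ∃ R ∈ L, ∃ β > t, R.eval β = 0) :
    ∃ R ∈ L, ∃ β > t, R.eval β = 0 ∧ ∀ S ∈ L, ∀ γ, t < γ → γ < β → S.eval γ ≠ 0 := by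
  obtain ⟨R, hR, α, hα, h0⟩ := ht
  obtain ⟨m, ⟨⟨T, hT, hm⟩, hmt⟩, hmin⟩ := Set.exists_min_image
    ({γ | ∃ R ∈ L, R.eval γ = 0} ∩ Set.Ioi t) id ((finite_roots_list h).inter_of_left _)
    ⟨α, ⟨R, hR, h0⟩, hα⟩
  exact ⟨T, hT, m, hmt, hm, fun S hS γ h₁ h₂ h₃ =>
    absurd (hmin γ ⟨⟨S, hS, h₃⟩, h₁⟩) (not_le.2 h₂)⟩

lemma strictMonoOn_Icc_of_derivative_pos {P : ℝ[X]} {α β : ℝ}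
    (h : ∀ γ, α < γ → γ < β → 0 < P.derivative.eval γ) :
    StrictMonoOn (fun t => P.eval t) (Set.Icc α β) := by
  refine strictMonoOn_of_deriv_pos (convex_Icc _ _) P.continuous.continuousOn fun γ hγ => ?_
  rw [interior_Icc] at hγ
  simpa using h γ hγ.1 hγ.2

/-- A root at which all members of a list, including the derivative, are positive is detected by
two consecutive roots of members of the list. -/
lemma exists_root_pos_iff {P : ℝ[X]} {L : List ℝ[X]} (hd : P.derivative ∈ L)
    (hb : ∀ t, P.eval t = 0 →
      (∃ R ∈ L, ∃ α < t, R.eval α = 0) ∧ ∃ R ∈ L, ∃ β > t, R.eval β = 0) :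
    (∃ t, P.eval t = 0 ∧ ∀ R ∈ L, 0 < R.eval t) ↔
      ∃ R₁ ∈ L, ∃ R₂ ∈ L, ∃ α, R₁.eval α = 0 ∧ ∃ β, R₂.eval β = 0 ∧
        (α < β ∧ P.eval α < 0 ∧ 0 < P.eval β ∧
          (∀ R ∈ L, ¬ ∃ γ, R.eval γ = 0 ∧ α < γ ∧ γ < β) ∧
          ∀ R ∈ L, 0 < R.eval ((α + β) / 2)) := by
  constructor
  · rintro ⟨t, ht, hL⟩
    have hne : ∀ R ∈ L, R ≠ 0 := by
      rintro R hR rfl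
      simpa using hL _ hR
    obtain ⟨R₁, hR₁, α, hα, h₁, hα'⟩ := exists_greatest_root hne (hb t ht).1
    obtain ⟨R₂, hR₂, β, hβ, h₂, hβ'⟩ := exists_least_root hne (hb t ht).2
    have hno : ∀ R ∈ L, ∀ γ ∈ Set.Ioo α β, R.eval γ ≠ 0 := by
      rintro R hR γ ⟨hγ, hγ'⟩
      rcases lt_trichotomy γ t with h | rfl | h
      exacts [hα' R hR γ hγ h, (hL R hR).ne', hβ' R hR γ h hγ']
    have hpos : ∀ R ∈ L, ∀ γ ∈ Set.Ioo α β, 0 < R.eval γ := fun R hR γ hγ =>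
      eval_pos_of_forall_ne_zero Set.ordConnected_Ioo (hno R hR) ⟨hα, hβ⟩ hγ (hL R hR)
    have hmono := strictMonoOn_Icc_of_derivative_pos fun γ h h' => hpos _ hd γ ⟨h, h'⟩
    have hαβ : α < β := hα.trans hβ
    refine ⟨R₁, hR₁, R₂, hR₂, α, h₁, β, h₂, hαβ, ?_, ?_, ?_, ?_⟩
    · simpa [ht] using hmono ⟨le_rfl, hαβ.le⟩ ⟨hα.le, hβ.le⟩ hα
    · simpa [ht] using hmono ⟨hα.le, hβ.le⟩ ⟨hαβ.le, le_rfl⟩ hβ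
    · rintro R hR ⟨γ, h, hγ⟩
      exact hno R hR γ hγ h
    · exact fun R hR => hpos R hR _ ⟨by linarith, by linarith⟩
  · rintro ⟨-, -, -, -, α, -, β, -, hαβ, hPα, hPβ, hno, hmid⟩
    obtain ⟨t, ht, ht'⟩ := intermediate_value_Ioo hαβ.le P.continuous.continuousOn ⟨hPα, hPβ⟩
    exact ⟨t, ht', fun R hR => eval_pos_of_forall_ne_zero Set.ordConnected_Ioo
      (fun γ hγ h => hno R hR ⟨γ, h, hγ⟩) (u := (α + β) / 2) ⟨by linarith, by linarith⟩ ht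
      (hmid R hR)⟩

/-- The solvability of a system of strict inequalities in one variable is detected at `0`, at
the roots of the product shifted by `1`, and at the critical points of the product. -/
lemma exists_pos_iff (L : List ℝ[X]) :
    (∃ t, ∀ R ∈ L, 0 < R.eval t) ↔
      (∀ R ∈ L, 0 < R.eval 0) ∨
      (L.prod ≠ 0 ∧ ∃ t, L.prod.eval t = 0 ∧ ∀ R ∈ L, 0 < R.eval (t + 1)) ∨
      (L.prod ≠ 0 ∧ ∃ t, L.prod.eval t = 0 ∧ ∀ R ∈ L, 0 < R.eval (t - 1)) ∨
      (L.prod.derivative ≠ 0 ∧ ∃ t, L.prod.derivative.eval t = 0 ∧ ∀ R ∈ L, 0 < R.eval t) := by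
  constructor
  · rintro ⟨t, ht⟩
    have hne : ∀ R ∈ L, R ≠ 0 := by
      rintro R hR rfl
      simpa using ht _ hR
    have hW : L.prod ≠ 0 := by
      rw [Ne, List.prod_eq_zero_iff]
      exact fun h0 => hne 0 h0 rfl
    have hroot : ∀ R ∈ L, ∀ γ, R.eval γ = 0 → L.prod.eval γ = 0 := by
      intro R hR γ h
      obtain ⟨S, hS⟩ := List.dvd_prod hR
      simp [hS, h]
    by_cases ha : ∃ R ∈ L, ∃ α < t, R.eval α = 0
    · obtain ⟨R₁, hR₁, α, hα, h₁, hα'⟩ := exists_greatest_root hne ha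
      by_cases hb : ∃ R ∈ L, ∃ β > t, R.eval β = 0
      · obtain ⟨R₂, hR₂, β, hβ, h₂, hβ'⟩ := exists_least_root hne hb
        right; right; right
        have hno : ∀ R ∈ L, ∀ γ ∈ Set.Ioo α β, R.eval γ ≠ 0 := by
          rintro R hR γ ⟨hγ, hγ'⟩
          rcases lt_trichotomy γ t with h | rfl | h
          exacts [hα' R hR γ hγ h, (ht R hR).ne', hβ' R hR γ h hγ']
        obtain ⟨γ, hγ, h0⟩ := exists_deriv_eq_zero (hα.trans hβ)
          L.prod.continuous.continuousOn ((hroot _ hR₁ _ h₁).trans (hroot _ hR₂ _ h₂).symm)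
        refine ⟨fun h => ?_, γ, by simpa using h0, fun R hR => eval_pos_of_forall_ne_zero
          Set.ordConnected_Ioo (hno R hR) ⟨hα, hβ⟩ hγ (ht R hR)⟩
        have h3 : L.prod.eval t = L.prod.eval α := by
          rw [eq_C_of_natDegree_eq_zero (derivative_eq_zero.1 h)]
          simp
        rw [hroot _ hR₁ _ h₁, eval_list_prod, List.prod_eq_zero_iff] at h3
        simp only [List.mem_map] at h3
        obtain ⟨R, hR, h3⟩ := h3
        exact (ht R hR).ne' h3
      · push Not at hb
        right; left
        refine ⟨hW, α, hroot _ hR₁ _ h₁, fun R hR => eval_pos_of_forall_ne_zero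
          (Set.ordConnected_Ioi (a := α)) (fun γ hγ => ?_) hα (lt_add_one α) (ht R hR)⟩
        rcases lt_trichotomy γ t with h | rfl | h
        exacts [hα' R hR γ hγ h, (ht R hR).ne', hb R hR γ h]
    · push Not at ha
      by_cases hb : ∃ R ∈ L, ∃ β > t, R.eval β = 0
      · obtain ⟨R₂, hR₂, β, hβ, h₂, hβ'⟩ := exists_least_root hne hb
        right; right; left
        refine ⟨hW, β, hroot _ hR₂ _ h₂, fun R hR => eval_pos_of_forall_ne_zero
          (Set.ordConnected_Iio (a := β)) (fun γ hγ => ?_) hβ (sub_one_lt β) (ht R hR)⟩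
        rcases lt_trichotomy γ t with h | rfl | h
        exacts [ha R hR γ h, (ht R hR).ne', hβ' R hR γ h hγ]
      · push Not at hb
        left
        refine fun R hR => eval_pos_of_forall_ne_zero Set.ordConnected_univ (fun γ _ => ?_)
          (Set.mem_univ t) (Set.mem_univ 0) (ht R hR)
        rcases lt_trichotomy γ t with h | rfl | h
        exacts [ha R hR γ h, (ht R hR).ne', hb R hR γ h]
  · rintro (h | ⟨-, t, -, h⟩ | ⟨-, t, -, h⟩ | ⟨-, t, -, h⟩)
    exacts [⟨_, h⟩, ⟨_, h⟩, ⟨_, h⟩, ⟨_, h⟩]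

/-- A root bound in terms of squares of coefficients. -/
lemma sq_coeff_mul_abs_root_lt {P : ℝ[X]} {d : ℕ} (hP : P.natDegree ≤ d + 1) {t : ℝ}
    (ht : P.eval t = 0) :
    P.coeff (d + 1) ^ 2 * |t| < 1 + P.coeff (d + 1) ^ 2 +
      ∑ i ∈ Finset.range (d + 1), (P.coeff (d + 1) ^ 2 + P.coeff i ^ 2) := by
  set a := P.coeff (d + 1) with ha
  have hs : 0 ≤ ∑ i ∈ Finset.range (d + 1), (a ^ 2 + P.coeff i ^ 2) := by positivity
  rcases le_total |t| 1 with h | h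
  · nlinarith [mul_le_mul_of_nonneg_left h (sq_nonneg a)]
  rw [eval_eq_sum_range' (Nat.lt_succ_of_le hP), Finset.sum_range_succ] at ht
  have h₁ : |a| * |t| ^ (d + 1) ≤ (∑ i ∈ Finset.range (d + 1), |P.coeff i|) * |t| ^ d := by
    have : a * t ^ (d + 1) = -∑ i ∈ Finset.range (d + 1), P.coeff i * t ^ i := by linarith
    rw [← abs_pow, ← abs_mul, this, abs_neg, Finset.sum_mul]
    refine (Finset.abs_sum_le_sum_abs _ _).trans (Finset.sum_le_sum fun i hi => ?_)
    rw [abs_mul, abs_pow]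
    gcongr
    exact Nat.lt_succ_iff.1 (Finset.mem_range.1 hi)
  have h₂ : |a| * |t| ≤ ∑ i ∈ Finset.range (d + 1), |P.coeff i| := by
    have : 0 < |t| ^ d := by positivity
    refine le_of_mul_le_mul_right ?_ this
    calc |a| * |t| * |t| ^ d = |a| * |t| ^ (d + 1) := by ring
      _ ≤ _ := h₁
  have h₃ : a ^ 2 * |t| ≤ ∑ i ∈ Finset.range (d + 1), (a ^ 2 + P.coeff i ^ 2) := by
    calc a ^ 2 * |t| = |a| * (|a| * |t|) := by rw [← sq_abs]; ring
      _ ≤ |a| * ∑ i ∈ Finset.range (d + 1), |P.coeff i| := by gcongr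
      _ = ∑ i ∈ Finset.range (d + 1), |a| * |P.coeff i| := Finset.mul_sum _ _ _
      _ ≤ _ := by
        refine Finset.sum_le_sum fun i _ => ?_
        rw [← sq_abs a, ← sq_abs (P.coeff i)]
        nlinarith [sq_nonneg (|a| - |P.coeff i|), sq_nonneg |a|, sq_nonneg |P.coeff i|]
  nlinarith [sq_nonneg a]

/-! ### Elimination of one quantifier -/

section Elimination

variable {X : Type} {A : Subalgebra ℝ (X → ℝ)}

/-- Pseudo-division: at the roots of `P`, the sign of `Q` is the sign of a polynomial of lower
degree than `P`. -/
lemma exists_remainder {d : ℕ} {P : X → ℝ[X]} (hP : IsFamily A (d + 1) P) {e : ℕ}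
    {Q : X → ℝ[X]} (hQ : IsFamily A e Q) :
    ∃ R, IsFamily A d R ∧ ∀ x, (P x).coeff (d + 1) ≠ 0 → ∀ t, (P x).eval t = 0 →
      ∃ c > 0, (R x).eval t = c * (Q x).eval t := by
  induction e generalizing Q with
  | zero => exact ⟨Q, hQ.mono d.zero_le, fun x _ t _ => ⟨1, one_pos, by simp⟩⟩
  | succ e ih =>
    rcases Nat.lt_or_ge e d with h | h
    · exact ⟨Q, hQ.mono h, fun x _ t _ => ⟨1, one_pos, by simp⟩⟩
    have h₁ := (IsFamily.const (pow_mem' (hP.1 (d + 1)) 2)).mul hQ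
    have h₂ := ((IsFamily.monomial (mul_mem' (hP.1 (d + 1)) (hQ.1 (e + 1))) (e - d)).mul hP).neg
    obtain ⟨R, hR, hR'⟩ := ih (Q := fun x => C ((P x).coeff (d + 1) ^ 2) * Q x +
      -(Polynomial.monomial (e - d) ((P x).coeff (d + 1) * (Q x).coeff (e + 1)) * P x))
      ⟨(h₁.add h₂).1, fun x => by
        rw [natDegree_le_iff_coeff_eq_zero]
        intro N hN
        obtain ⟨M, rfl⟩ : ∃ M, N = M + (e - d) := ⟨N - (e - d), by omega⟩
        rw [coeff_add, coeff_neg, coeff_monomial_mul, coeff_C_mul]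
        rcases Nat.lt_or_ge (d + 1) M with h' | h'
        · rw [coeff_eq_zero_of_natDegree_lt ((hP.2 x).trans_lt h'),
            coeff_eq_zero_of_natDegree_lt ((hQ.2 x).trans_lt (by omega))]
          ring
        · obtain rfl : M = d + 1 := by omega
          have : d + 1 + (e - d) = e + 1 := by omega
          rw [this]
          ring⟩
    refine ⟨R, hR, fun x hx t ht => ?_⟩
    obtain ⟨c, hc, hc'⟩ := hR' x hx t ht
    exact ⟨c * (P x).coeff (d + 1) ^ 2, by positivity, by rw [hc']; simp [ht]; ring⟩

lemma exists_remainder_list {d : ℕ} {P : X → ℝ[X]} (hP : IsFamily A (d + 1) P)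
    (L : List (X × ℝ → ℝ)) (hL : ∀ q ∈ L, q ∈ prodAlg A lineAlg) :
    ∃ L' : List (X → ℝ[X]), (∀ R ∈ L', IsFamily A d R) ∧
      ∀ x, (P x).coeff (d + 1) ≠ 0 → ∀ t, (P x).eval t = 0 →
        ((∀ q ∈ L, 0 < q (x, t)) ↔ ∀ R ∈ L', 0 < (R x).eval t) := by
  induction L with
  | nil => exact ⟨[], by simp, by simp⟩
  | cons q L ih =>
    obtain ⟨L', h₁, h₂⟩ := ih fun p hp => hL p (by simp [hp])
    obtain ⟨e, Q, hQ, hq⟩ := exists_family_of_mem (hL q (by simp))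
    obtain ⟨R, hR, hR'⟩ := exists_remainder hP hQ
    refine ⟨R :: L', by simpa using ⟨hR, h₁⟩, fun x hx t ht => ?_⟩
    obtain ⟨c, hc, hc'⟩ := hR' x hx t ht
    simp only [List.mem_cons, forall_eq_or_imp, h₂ x hx t ht, hc', hq, mul_pos_iff_of_pos_left hc]

/-- Elimination of a quantifier that ranges over the roots of a polynomial of degree at most `d`. -/
def RootElim (d : ℕ) : Prop :=
  ∀ (X : Type) (A : Subalgebra ℝ (X → ℝ)) (P : X → ℝ[X]), IsFamily A d P →
    ∀ S : Set (X × ℝ), SignSet (prodAlg A lineAlg) S →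
      SignSet A {x | P x ≠ 0 ∧ ∃ t, (P x).eval t = 0 ∧ (x, t) ∈ S}

lemma SignSet.eval_pos {d : ℕ} {P : X → ℝ[X]} (hP : IsFamily A d P) {φ : X → ℝ} (hφ : φ ∈ A) :
    SignSet A {x | 0 < (P x).eval (φ x)} := by
  refine (SignSet.pos hP.eval_mem).preimage (φ := fun x => (x, φ x)) ?_
  exact prodAlg_le_comap (fun _ h => h) (lineAlg_le_comap hφ)

lemma signSet_consecutive_roots {d : ℕ} (ih : RootElim d) {e : ℕ} {P : X → ℝ[X]}
    (hP : IsFamily A e P) (L : List (X → ℝ[X])) (hL : ∀ R ∈ L, IsFamily A d R) :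
    SignSet A {x | ∃ R₁ ∈ L, ∃ R₂ ∈ L, R₁ x ≠ 0 ∧ ∃ α, (R₁ x).eval α = 0 ∧
      (R₂ x ≠ 0 ∧ ∃ β, (R₂ x).eval β = 0 ∧
        (α < β ∧ (P x).eval α < 0 ∧ 0 < (P x).eval β ∧
          (∀ R ∈ L, ¬ (R x ≠ 0 ∧ ∃ γ, (R x).eval γ = 0 ∧ (α < γ ∧ γ < β))) ∧
          ∀ R ∈ L, 0 < (R x).eval ((α + β) / 2)))} := by
  have f₁ : A ≤ (prodAlg A lineAlg).comap (pullback fun z : X × ℝ => z.1) := le_comap_fst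
  have f₂ := comap_trans (A := prodAlg (prodAlg A lineAlg) lineAlg) Prod.fst Prod.fst
    le_comap_fst f₁
  have hα : (fun z : (X × ℝ) × ℝ => z.1.2) ∈ prodAlg (prodAlg A lineAlg) lineAlg :=
    comp_fst_mem snd_mem
  have hβ : (fun z : (X × ℝ) × ℝ => z.2) ∈ prodAlg (prodAlg A lineAlg) lineAlg := snd_mem
  refine SignSet.list_exists L fun R₁ h₁ => SignSet.list_exists L fun R₂ h₂ => ?_
  refine ih X A R₁ (hL _ h₁) {z | R₂ z.1 ≠ 0 ∧ ∃ β, (R₂ z.1).eval β = 0 ∧ (z.2 < β ∧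
      (P z.1).eval z.2 < 0 ∧ 0 < (P z.1).eval β ∧
      (∀ R ∈ L, ¬ (R z.1 ≠ 0 ∧ ∃ γ, (R z.1).eval γ = 0 ∧ (z.2 < γ ∧ γ < β))) ∧
      ∀ R ∈ L, 0 < (R z.1).eval ((z.2 + β) / 2))} ?_
  refine ih (X × ℝ) _ (fun z => R₂ z.1) ((hL _ h₂).comp f₁) {z | z.1.2 < z.2 ∧
      (P z.1.1).eval z.1.2 < 0 ∧ 0 < (P z.1.1).eval z.2 ∧
      (∀ R ∈ L, ¬ (R z.1.1 ≠ 0 ∧ ∃ γ, (R z.1.1).eval γ = 0 ∧ (z.1.2 < γ ∧ γ < z.2))) ∧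
      ∀ R ∈ L, 0 < (R z.1.1).eval ((z.1.2 + z.2) / 2)} ?_
  refine (SignSet.lt hα hβ).and (.and ?_ (.and ?_ (.and ?_ ?_)))
  · simpa using SignSet.eval_pos (hP.comp f₂).neg hα
  · exact SignSet.eval_pos (hP.comp f₂) hβ
  · refine SignSet.list_forall L fun R hR => SignSet.not ?_
    exact ih ((X × ℝ) × ℝ) _ (fun z => R z.1.1) ((hL _ hR).comp f₂)
      {z | z.1.1.2 < z.2 ∧ z.2 < z.1.2}
      ((SignSet.lt (comp_fst_mem hα) snd_mem).and (SignSet.lt snd_mem (comp_fst_mem hβ)))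
  · refine SignSet.list_forall L fun R hR => SignSet.eval_pos ((hL _ hR).comp f₂) ?_
    simpa [div_eq_mul_inv] using mul_mem' (add_mem' hα hβ) (const_mem 2⁻¹)

lemma signSet_exists_root_pos {d : ℕ} (ih : RootElim d) {P : X → ℝ[X]}
    (hP : IsFamily A (d + 1) P) (L : List (X → ℝ[X])) (hL : ∀ R ∈ L, IsFamily A d R)
    (hd : (fun x => (P x).derivative) ∈ L) :
    SignSet A {x | (P x).coeff (d + 1) ≠ 0 ∧
      ∃ t, (P x).eval t = 0 ∧ ∀ R ∈ L, 0 < (R x).eval t} := by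
  rcases Nat.eq_zero_or_pos d with rfl | hd0
  · convert (SignSet.ne_zero (hP.1 1)).and (SignSet.list_forall L fun R hR =>
      SignSet.pos ((hL R hR).1 0)) using 1
    ext x
    simp only [Set.mem_ofPred_eq, zero_add]
    refine and_congr_right fun hx => ?_
    have hR : ∀ R ∈ L, ∀ t, (R x).eval t = (R x).coeff 0 := by
      intro R hR t
      rw [eq_C_of_natDegree_le_zero ((hL R hR).2 x)]
      simp
    constructor
    · rintro ⟨t, -, ht⟩ R h
      rw [← hR R h t]
      exact ht R h
    · intro h
      refine ⟨-(P x).coeff 0 / (P x).coeff 1, ?_, fun R h' => by rw [hR R h']; exact h R h'⟩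
      rw [eval_eq_sum_range' (Nat.lt_succ_of_le (hP.2 x))]
      simp [Finset.sum_range_succ]
      field_simp
      ring
  · let a : X → ℝ := fun x => (P x).coeff (d + 1)
    let M : X → ℝ := fun x =>
      1 + a x ^ 2 + ∑ i ∈ Finset.range (d + 1), (a x ^ 2 + (P x).coeff i ^ 2)
    have ha : a ∈ A := hP.1 _
    have hM : M ∈ A := add_mem' (add_mem' (const_mem 1) (pow_mem' ha 2))
      (sum_mem' _ fun i _ => add_mem' (pow_mem' ha 2) (pow_mem' (hP.1 i) 2))
    let U : X → ℝ[X] := fun x => C (M x) + Polynomial.monomial 1 (-a x ^ 2)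
    let V : X → ℝ[X] := fun x => C (M x) + Polynomial.monomial 1 (a x ^ 2)
    have hU : IsFamily A d U :=
      ((IsFamily.const hM).add (IsFamily.monomial (neg_mem' (pow_mem' ha 2)) 1)).mono (by simpa)
    have hV : IsFamily A d V :=
      ((IsFamily.const hM).add (IsFamily.monomial (pow_mem' ha 2) 1)).mono (by simpa)
    have hL' : ∀ R ∈ U :: V :: L, IsFamily A d R := by
      simpa using ⟨hU, hV, hL⟩
    convert (SignSet.ne_zero (hP.1 (d + 1))).and
      (signSet_consecutive_roots ih hP (U :: V :: L) hL') using 1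
    ext x
    simp only [Set.mem_ofPred_eq]
    refine and_congr_right fun hx => ?_
    have hbound : ∀ t, (P x).eval t = 0 → a x ^ 2 * |t| < M x := fun t ht =>
      sq_coeff_mul_abs_root_lt (hP.2 x) ht
    have ha2 : 0 < a x ^ 2 := by positivity
    have hs : a x ^ 2 * (M x / a x ^ 2) = M x := mul_div_cancel₀ _ ha2.ne'
    have key := exists_root_pos_iff (P := P x) (L := (U :: V :: L).map fun R => R x)
      (List.mem_map.2 ⟨_, List.mem_cons_of_mem _ (List.mem_cons_of_mem _ hd), rfl⟩) (fun t ht => by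
        have hb := hbound t ht
        constructor
        · refine ⟨V x, List.mem_map.2 ⟨V, by simp, rfl⟩, -(M x / a x ^ 2), ?_, ?_⟩
          · rw [neg_lt, lt_div_iff₀ ha2]
            nlinarith [neg_abs_le t]
          · simp only [V, eval_add, eval_C, eval_monomial, pow_one]
            linear_combination -hs
        · refine ⟨U x, List.mem_map.2 ⟨U, by simp, rfl⟩, M x / a x ^ 2, ?_, ?_⟩
          · rw [gt_iff_lt, lt_div_iff₀ ha2]
            nlinarith [le_abs_self t]
          · simp only [U, eval_add, eval_C, eval_monomial, pow_one]
            linear_combination -hs)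
    have e₁ : (∃ t, (P x).eval t = 0 ∧ ∀ R ∈ L, 0 < (R x).eval t) ↔
        ∃ t, (P x).eval t = 0 ∧ ∀ R ∈ (U :: V :: L).map fun R => R x, 0 < R.eval t := by
      refine exists_congr fun t => and_congr_right fun ht => ?_
      have hb := hbound t ht
      have hUt : 0 < (U x).eval t := by
        simp [U]
        nlinarith [le_abs_self t]
      have hVt : 0 < (V x).eval t := by
        simp [V]
        nlinarith [neg_abs_le t]
      simp [hUt, hVt]
    rw [e₁, key]
    simp only [List.mem_map, exists_exists_and_eq_and, forall_exists_index, and_imp,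
      forall_apply_eq_imp_iff₂]
    constructor
    · rintro ⟨R₁, h₁, R₂, h₂, α, hα, β, hβ, h, hPα, hPβ, hno, hmid⟩
      have hne : ∀ R ∈ U :: V :: L, R x ≠ 0 := fun R hR h0 => by
        simpa [h0] using hmid R hR
      exact ⟨R₁, h₁, R₂, h₂, hne _ h₁, α, hα, hne _ h₂, β, hβ, h, hPα, hPβ,
        fun R hR h' => hno R hR h'.2, hmid⟩
    · rintro ⟨R₁, h₁, R₂, h₂, -, α, hα, -, β, hβ, h, hPα, hPβ, hno, hmid⟩
      have hne : ∀ R ∈ U :: V :: L, R x ≠ 0 := fun R hR h0 => by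
        simpa [h0] using hmid R hR
      exact ⟨R₁, h₁, R₂, h₂, α, hα, β, hβ, h, hPα, hPβ,
        fun R hR h' => hno R hR ⟨hne R hR, h'⟩, hmid⟩

lemma signSet_exists_root_pos_of_coeff_ne_zero {d : ℕ} (ih : RootElim d) {P : X → ℝ[X]}
    (hP : IsFamily A (d + 1) P) (L : List (X → ℝ[X])) (hL : ∀ R ∈ L, IsFamily A d R) :
    SignSet A {x | (P x).coeff (d + 1) ≠ 0 ∧
      ∃ t, (P x).eval t = 0 ∧ ∀ R ∈ L, 0 < (R x).eval t} := by
  have hD := hP.derivative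
  have hD0 : ∀ x, (P x).coeff (d + 1) ≠ 0 → (P x).derivative ≠ 0 := by
    intro x hx h
    have : (P x).derivative.coeff d = 0 := by simp [h]
    rw [coeff_derivative, mul_eq_zero] at this
    rcases this with h | h
    · exact hx h
    · exact (Nat.cast_add_one_pos d).ne' h
  have key := SignSet.or ((SignSet.ne_zero (hP.1 (d + 1))).and
      (ih X A _ hD {z | (P z.1).eval z.2 = 0 ∧ ∀ R ∈ L, 0 < (R z.1).eval z.2}
        ((SignSet.eq_zero hP.eval_mem).and
          (SignSet.list_forall L fun R hR => SignSet.pos (hL R hR).eval_mem))))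
    ((signSet_exists_root_pos ih hP ((fun x => (P x).derivative) :: L)
        (by simpa using ⟨hD, hL⟩) (by simp)).or
      (signSet_exists_root_pos ih hP.neg ((fun x => (-P x).derivative) :: L)
        (by simpa using ⟨hD.neg, hL⟩) (by simp)))
  convert key using 1
  ext x
  simp only [Set.mem_ofPred_eq, List.mem_cons, forall_eq_or_imp, coeff_neg, neg_ne_zero, eval_neg,
    neg_eq_zero, derivative_neg, neg_pos, ← and_or_left]
  refine and_congr_right fun hx => ?_
  constructor
  · rintro ⟨t, ht, h⟩
    rcases lt_trichotomy ((P x).derivative.eval t) 0 with h' | h' | h'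
    · exact Or.inr (Or.inr ⟨t, ht, h', h⟩)
    · exact Or.inl ⟨hD0 x hx, t, h', ht, h⟩
    · exact Or.inr (Or.inl ⟨t, ht, h', h⟩)
  · rintro (⟨-, t, -, ht, h⟩ | ⟨t, ht, -, h⟩ | ⟨t, ht, -, h⟩) <;> exact ⟨t, ht, h⟩

lemma signSet_root_of_coeff_ne_zero {d : ℕ} (ih : RootElim d) {P : X → ℝ[X]}
    (hP : IsFamily A (d + 1) P) {S : Set (X × ℝ)} (hS : SignSet (prodAlg A lineAlg) S) :
    SignSet A {x | (P x).coeff (d + 1) ≠ 0 ∧ ∃ t, (P x).eval t = 0 ∧ (x, t) ∈ S} := by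
  induction hS with
  | union _ _ i₁ i₂ =>
    convert i₁.or i₂ using 1
    ext x
    simp only [Set.mem_ofPred_eq, Set.mem_union, ← and_or_left, ← exists_or]
  | basic p hp L hL =>
    obtain ⟨e, Q, hQ, hq⟩ := exists_family_of_mem hp
    obtain ⟨R₀, hR₀, hR₀'⟩ := exists_remainder hP hQ
    obtain ⟨L', hL', hLL'⟩ := exists_remainder_list hP L hL
    have key := ((SignSet.ne_zero (hP.1 (d + 1))).and
      (ih X A _ hR₀ {z | (P z.1).eval z.2 = 0 ∧ ∀ R ∈ L', 0 < (R z.1).eval z.2}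
        ((SignSet.eq_zero hP.eval_mem).and
          (SignSet.list_forall L' fun R hR => SignSet.pos (hL' R hR).eval_mem)))).or
      ((signSet_exists_root_pos_of_coeff_ne_zero ih hP L' hL').and hR₀.signSet_ne_zero.not)
    convert key using 1
    ext x
    simp only [Set.mem_ofPred_eq, not_not, and_assoc, ← and_or_left]
    refine and_congr_right fun hx => ?_
    have h₁ : ∀ t, (P x).eval t = 0 → (p (x, t) = 0 ↔ (R₀ x).eval t = 0) := by
      intro t ht
      obtain ⟨c, hc, hc'⟩ := hR₀' x hx t ht
      rw [hc', hq, mul_eq_zero, or_iff_right hc.ne']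
    constructor
    · rintro ⟨t, ht, hpt, hLt⟩
      rw [hLL' x hx t ht] at hLt
      rw [h₁ t ht] at hpt
      by_cases h0 : R₀ x = 0
      exacts [Or.inr ⟨⟨t, ht, hLt⟩, h0⟩, Or.inl ⟨h0, t, hpt, ht, hLt⟩]
    · rintro (⟨-, t, hpt, ht, hLt⟩ | ⟨⟨t, ht, hLt⟩, h0⟩)
      · exact ⟨t, ht, (h₁ t ht).2 hpt, (hLL' x hx t ht).2 hLt⟩
      · exact ⟨t, ht, (h₁ t ht).2 (by simp [h0]), (hLL' x hx t ht).2 hLt⟩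

end Elimination

theorem rootElim (d : ℕ) : RootElim d := by
  induction d with
  | zero =>
    intro X A P hP S hS
    convert SignSet.empty (A := A) using 1
    ext x
    simp only [Set.mem_ofPred_eq, Set.mem_empty_iff_false, iff_false, not_and, not_exists]
    intro hx t ht
    rw [eq_C_of_natDegree_le_zero (hP.2 x), eval_C] at ht
    rw [eq_C_of_natDegree_le_zero (hP.2 x), ht] at hx
    simp at hx
  | succ d ih =>
    intro X A P hP S hS
    have hE : IsFamily A d fun x => P x +
        -Polynomial.monomial (d + 1) ((P x).coeff (d + 1)) := by
      refine ⟨(hP.add (IsFamily.monomial (hP.1 (d + 1)) (d + 1)).neg).1, fun x => ?_⟩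
      rw [natDegree_le_iff_coeff_eq_zero]
      intro N hN
      rw [coeff_add, coeff_neg, coeff_monomial]
      split_ifs with h
      · simp [h]
      · rw [coeff_eq_zero_of_natDegree_lt ((hP.2 x).trans_lt (by omega))]
        simp
    convert (signSet_root_of_coeff_ne_zero ih hP hS).or
      ((SignSet.eq_zero (hP.1 (d + 1))).and (ih X A _ hE S hS)) using 1
    ext x
    simp only [Set.mem_ofPred_eq]
    by_cases hx : (P x).coeff (d + 1) = 0
    · simp [hx]
    · have : P x ≠ 0 := by
        rintro h
        simp [h] at hx
      simp [hx, this]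

lemma exists_family_list {X : Type} {A : Subalgebra ℝ (X → ℝ)} (L : List (X × ℝ → ℝ))
    (hL : ∀ q ∈ L, q ∈ prodAlg A lineAlg) :
    ∃ L' : List (X → ℝ[X]), (∀ R ∈ L', ∃ d, IsFamily A d R) ∧
      (∃ d, IsFamily A d fun x => (L'.map fun R => R x).prod) ∧
      ∀ x t, (∀ q ∈ L, 0 < q (x, t)) ↔ ∀ R ∈ L', 0 < (R x).eval t := by
  induction L with
  | nil => exact ⟨[], by simp, ⟨0, by simpa using IsFamily.const (A := A) (const_mem 1)⟩, by simp⟩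
  | cons q L ih =>
    obtain ⟨L', h₁, ⟨d, h₂⟩, h₃⟩ := ih fun p hp => hL p (by simp [hp])
    obtain ⟨e, Q, hQ, hq⟩ := exists_family_of_mem (hL q (by simp))
    exact ⟨Q :: L', by simpa using ⟨⟨e, hQ⟩, h₁⟩, ⟨_, by simpa using hQ.mul h₂⟩,
      fun x t => by simp [h₃, hq]⟩

/-- The Tarski–Seidenberg theorem for one variable. -/
theorem SignSet.exists_real {X : Type} {A : Subalgebra ℝ (X → ℝ)} {S : Set (X × ℝ)}
    (hS : SignSet (prodAlg A lineAlg) S) : SignSet A {x | ∃ t, (x, t) ∈ S} := by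
  induction hS with
  | union _ _ i₁ i₂ =>
    convert i₁.or i₂ using 1
    ext x
    simp only [Set.mem_ofPred_eq, Set.mem_union, ← exists_or]
  | basic p hp L hL =>
    obtain ⟨e, Q, hQ, hq⟩ := exists_family_of_mem hp
    obtain ⟨L', hL', ⟨d, hd⟩, hLL'⟩ := exists_family_list L hL
    have hd' := (hd.mono d.le_succ).derivative
    have hpos : SignSet (prodAlg A lineAlg) {z | ∀ R ∈ L', 0 < (R z.1).eval z.2} :=
      SignSet.list_forall L' fun R hR => (hL' R hR).elim fun _ h => SignSet.pos h.eval_mem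
    have hshift : ∀ c : ℝ, SignSet (prodAlg A lineAlg)
        {z | ∀ R ∈ L', 0 < (R z.1).eval (z.2 + c)} := fun c =>
      hpos.preimage (φ := fun z : X × ℝ => (z.1, z.2 + c))
        (prodAlg_le_comap (φ := fun z : X × ℝ => (z.1, z.2 + c)) le_comap_fst
          (lineAlg_le_comap (add_mem' snd_mem (const_mem c))))
    have h0 : SignSet A {x | ∀ R ∈ L', 0 < (R x).eval 0} :=
      hpos.preimage (φ := fun x : X => (x, (0 : ℝ)))
        (prodAlg_le_comap (φ := fun x : X => (x, (0 : ℝ))) (fun _ h => h)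
          (lineAlg_le_comap (const_mem 0)))
    have key := (rootElim e X A Q hQ _ hpos).or (hQ.signSet_ne_zero.not.and
      (h0.or ((rootElim d X A _ hd _ (hshift 1)).or ((rootElim d X A _ hd _ (hshift (-1))).or
        (rootElim d X A _ hd' _ hpos)))))
    convert key using 1
    ext x
    have e₁ := exists_pos_iff (L'.map fun R => R x)
    simp only [List.forall_mem_map] at e₁
    simp only [Set.mem_ofPred_eq, not_not, hq, hLL', ← sub_eq_add_neg, ← e₁]
    by_cases hx : Q x = 0 <;> simp [hx]

/-! ### Elimination of several quantifiers -/

/-- Projections along `Z` preserve sets described by sign conditions. -/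
def Eliminable {Z : Type} (C : Subalgebra ℝ (Z → ℝ)) : Prop :=
  ∀ (X : Type) (A : Subalgebra ℝ (X → ℝ)) (S : Set (X × Z)), SignSet (prodAlg A C) S →
    SignSet A {x | ∃ z, (x, z) ∈ S}

namespace Eliminable

variable {Y Z : Type} {B : Subalgebra ℝ (Y → ℝ)} {C : Subalgebra ℝ (Z → ℝ)}

lemma line : Eliminable lineAlg := fun _ _ _ hS => hS.exists_real

lemma prod (hB : Eliminable B) (hC : Eliminable C) : Eliminable (prodAlg B C) := by
  intro X A S hS
  have h₁ : prodAlg A (prodAlg B C) ≤ (prodAlg (prodAlg A B) C).comap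
      (pullback fun w : (X × Y) × Z => (w.1.1, (w.1.2, w.2))) := by
    refine prodAlg_le_comap ?_ (prodAlg_le_comap ?_ le_comap_snd)
    · exact comap_trans Prod.fst Prod.fst le_comap_fst le_comap_fst
    · exact comap_trans Prod.fst Prod.snd le_comap_fst le_comap_snd
  convert hB X A _ (hC _ _ _ (hS.preimage (φ := fun w : (X × Y) × Z => (w.1.1, (w.1.2, w.2))) h₁))
    using 1
  ext x
  simp

lemma of_surjective (hB : Eliminable B) {φ : Y → Z} (hφ : Function.Surjective φ)
    (h : C ≤ B.comap (pullback φ)) : Eliminable C := by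
  intro X A S hS
  have h₁ : prodAlg A C ≤ (prodAlg A B).comap
      (pullback fun w : X × Y => (w.1, φ w.2)) :=
    prodAlg_le_comap le_comap_fst (comap_trans Prod.snd φ le_comap_snd h)
  convert hB X A _ (hS.preimage (φ := fun w : X × Y => (w.1, φ w.2)) h₁) using 1
  ext x
  simp [hφ.exists]

lemma coord (n : ℕ) : Eliminable (coordAlg (Fin n)) := by
  induction n with
  | zero =>
    intro X A S hS
    have h₁ : prodAlg A (coordAlg (Fin 0)) ≤ A.comap (pullback fun x => (x, Fin.elim0)) :=
      prodAlg_le_comap (fun _ h => h) (coordAlg_le_comap fun i => i.elim0)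
    convert hS.preimage h₁ using 1
    ext x
    simp [Subsingleton.elim _ (Fin.elim0 : Fin 0 → ℝ), Unique.exists_iff]
  | succ n ih =>
    refine (line.prod ih).of_surjective (φ := fun w => Fin.cons w.1 w.2)
      (fun v => ⟨(v 0, Fin.tail v), Fin.cons_self_tail v⟩) (coordAlg_le_comap fun i => ?_)
    refine Fin.cases ?_ (fun j => ?_) i
    · exact comp_fst_mem id_mem_lineAlg
    · exact comp_snd_mem (coord_mem_coordAlg j)

end Eliminable

/-! ### Polynomial growth -/

/-- The algebra of functions bounded by a constant multiple of a power of `1 + ρ`. -/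
def growthAlg {Z : Type} (ρ : Z → ℝ) (hρ : ∀ z, 0 ≤ ρ z) : Subalgebra ℝ (Z → ℝ) where
  carrier := {F | ∃ C N, 0 ≤ C ∧ ∀ z, |F z| ≤ C * (1 + ρ z) ^ (N : ℕ)}
  mul_mem' := by
    rintro F G ⟨C, N, hC, h⟩ ⟨D, M, hD, h'⟩
    refine ⟨C * D, N + M, by positivity, fun z => ?_⟩
    have := hρ z
    calc |F z * G z| = |F z| * |G z| := abs_mul _ _
      _ ≤ (C * (1 + ρ z) ^ N) * (D * (1 + ρ z) ^ M) := by
        gcongr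
        exacts [h z, h' z]
      _ = _ := by ring
  add_mem' := by
    rintro F G ⟨C, N, hC, h⟩ ⟨D, M, hD, h'⟩
    refine ⟨C + D, N + M, by positivity, fun z => ?_⟩
    have h1 : 1 ≤ 1 + ρ z := by linarith [hρ z]
    calc |F z + G z| ≤ |F z| + |G z| := abs_add_le _ _
      _ ≤ C * (1 + ρ z) ^ N + D * (1 + ρ z) ^ M := add_le_add (h z) (h' z)
      _ ≤ C * (1 + ρ z) ^ (N + M) + D * (1 + ρ z) ^ (N + M) := by
        gcongr
        · omega
        · omega
      _ = _ := by ring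
  algebraMap_mem' c := ⟨|c|, 0, abs_nonneg c, fun z => by simp⟩

lemma mem_growthAlg_of_sq_le {Z : Type} {ρ : Z → ℝ} {hρ : ∀ z, 0 ≤ ρ z} {F : Z → ℝ}
    (h : ∀ z, F z ^ 2 ≤ ρ z) : F ∈ growthAlg ρ hρ := by
  refine ⟨1, 1, zero_le_one, fun z => ?_⟩
  rw [one_mul, pow_one, abs_le]
  constructor <;> nlinarith [h z, sq_nonneg (F z - 1), sq_nonneg (F z + 1)]

lemma exists_uniform_growth {Z : Type} {ρ : Z → ℝ} {hρ : ∀ z, 0 ≤ ρ z} (L : List (Z → ℝ))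
    (hL : ∀ F ∈ L, F ∈ growthAlg ρ hρ) :
    ∃ C N, 0 ≤ C ∧ ∀ F ∈ L, ∀ z, |F z| ≤ C * (1 + ρ z) ^ (N : ℕ) := by
  have : (fun z => (L.map fun F => |F z|).sum) ∈ growthAlg ρ hρ := by
    induction L with
    | nil =>
      simp only [List.map_nil, List.sum_nil]
      exact (growthAlg ρ hρ).zero_mem
    | cons F L ih =>
      simp only [List.map_cons, List.sum_cons]
      refine add_mem' ?_ (ih fun G hG => hL G (by simp [hG]))
      obtain ⟨C, N, hC, h⟩ := hL F (by simp)
      exact ⟨C, N, hC, fun z => by simpa using h z⟩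
  obtain ⟨C, N, hC, h⟩ := this
  refine ⟨C, N, hC, fun F hF z => le_trans ?_ ((le_abs_self _).trans (h z))⟩
  refine List.single_le_sum ?_ _ (List.mem_map.2 ⟨F, hF, rfl⟩)
  simp only [List.mem_map]
  rintro _ ⟨G, -, rfl⟩
  exact abs_nonneg _

lemma exists_polynomial_of_mem_lineAlg {a : ℝ → ℝ} (ha : a ∈ lineAlg) :
    ∃ p : ℝ[X], ∀ t, a t = p.eval t := by
  induction ha using Algebra.adjoin_induction with
  | mem x hx => exact ⟨Polynomial.X, by simp [Set.mem_singleton_iff.1 hx]⟩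
  | algebraMap r => exact ⟨C r, by simp⟩
  | add x y _ _ hx hy =>
    obtain ⟨p, hp⟩ := hx
    obtain ⟨q, hq⟩ := hy
    exact ⟨p + q, by simp [hp, hq]⟩
  | mul x y _ _ hx hy =>
    obtain ⟨p, hp⟩ := hx
    obtain ⟨q, hq⟩ := hy
    exact ⟨p * q, by simp [hp, hq]⟩

lemma eventually_sq_ge_of_mem_lineAlg {a : ℝ → ℝ} (ha : a ∈ lineAlg) :
    (∀ r, a r = 0) ∨ ∃ c > 0, ∃ r₀ ≥ 0, ∀ r ≥ r₀, c ≤ a r ^ 2 := by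
  obtain ⟨p, hp⟩ := exists_polynomial_of_mem_lineAlg ha
  simp only [hp]
  rcases le_or_gt p.degree 0 with h | h
  · rw [eq_C_of_degree_le_zero h]
    simp only [eval_C, forall_const]
    by_cases h0 : p.coeff 0 = 0
    · exact Or.inl h0
    · exact Or.inr ⟨p.coeff 0 ^ 2, by positivity, 0, le_rfl, fun _ _ => le_rfl⟩
  · right
    obtain ⟨r₀, hr₀⟩ := Filter.eventually_atTop.1
      ((p.abs_tendsto_atTop h).eventually_ge_atTop 1)
    refine ⟨1, one_pos, max r₀ 0, le_max_right _ _, fun r hr => ?_⟩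
    have := hr₀ r ((le_max_left _ _).trans hr)
    rw [← sq_abs]
    nlinarith

/-- For large `r`, membership of `(r, u)` in `M` does not depend on `u` when `u` exceeds a
polynomial bound in `r`. -/
def TailConstant (M : Set (ℝ × ℝ)) : Prop :=
  ∃ C N r₀, 0 ≤ C ∧ 0 ≤ r₀ ∧ ∀ r ≥ r₀, ∀ u v, C * (1 + r) ^ (N : ℕ) ≤ u →
    C * (1 + r) ^ N ≤ v → ((r, u) ∈ M ↔ (r, v) ∈ M)

namespace TailConstant

lemma combine {M₁ M₂ M : Set (ℝ × ℝ)} (h₁ : TailConstant M₁) (h₂ : TailConstant M₂)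
    (h : ∀ r u v, ((r, u) ∈ M₁ ↔ (r, v) ∈ M₁) → ((r, u) ∈ M₂ ↔ (r, v) ∈ M₂) →
      ((r, u) ∈ M ↔ (r, v) ∈ M)) : TailConstant M := by
  obtain ⟨C, N, r₀, hC, hr₀, h₁⟩ := h₁
  obtain ⟨D, K, r₁, hD, hr₁, h₂⟩ := h₂
  refine ⟨C + D, N + K, max r₀ r₁, by positivity, by positivity, fun r hr u v hu hv => ?_⟩
  have hr0 : 0 ≤ r := hr₀.trans ((le_max_left _ _).trans hr)
  have hr1 : 1 ≤ 1 + r := by linarith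
  have e₁ : C * (1 + r) ^ N ≤ (C + D) * (1 + r) ^ (N + K) := by
    gcongr
    · linarith
    · omega
  have e₂ : D * (1 + r) ^ K ≤ (C + D) * (1 + r) ^ (N + K) := by
    gcongr
    · linarith
    · omega
  exact h r u v
    (h₁ r ((le_max_left _ _).trans hr) u v (e₁.trans hu) (e₁.trans hv))
    (h₂ r ((le_max_right _ _).trans hr) u v (e₂.trans hu) (e₂.trans hv))

lemma eval_pos {d : ℕ} {P : ℝ → ℝ[X]} (hP : IsFamily lineAlg d P) :
    TailConstant {z | 0 < (P z.1).eval z.2} := by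
  induction d with
  | zero =>
    refine ⟨0, 0, 0, le_rfl, le_rfl, fun r _ u v _ _ => ?_⟩
    simp only [Set.mem_ofPred_eq]
    rw [eq_C_of_natDegree_le_zero (hP.2 r), eval_C, eval_C]
  | succ d ih =>
    rcases eventually_sq_ge_of_mem_lineAlg (hP.1 (d + 1)) with h | ⟨c, hc, r₀, hr₀, h⟩
    · refine ih ⟨hP.1, fun r => ?_⟩
      rw [natDegree_le_iff_coeff_eq_zero]
      intro N hN
      rcases (Nat.succ_le_of_lt hN).eq_or_lt with rfl | h'
      · exact h r
      · exact coeff_eq_zero_of_natDegree_lt ((hP.2 r).trans_lt h')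
    · let ρ : ℝ → ℝ := fun r => r ^ 2
      have hρ : ∀ r, 0 ≤ ρ r := fun r => sq_nonneg r
      have hle : lineAlg ≤ growthAlg ρ hρ :=
        lineAlg_le_comap (C := growthAlg ρ hρ) (φ := fun t => t)
          (mem_growthAlg_of_sq_le (ρ := ρ) (hρ := hρ) fun _ => le_rfl)
      have hM : (fun r => 1 + (P r).coeff (d + 1) ^ 2 + ∑ i ∈ Finset.range (d + 1),
          ((P r).coeff (d + 1) ^ 2 + (P r).coeff i ^ 2)) ∈ lineAlg :=
        add_mem' (add_mem' (const_mem 1) (pow_mem' (hP.1 _) 2))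
          (sum_mem' _ fun i _ => add_mem' (pow_mem' (hP.1 _) 2) (pow_mem' (hP.1 i) 2))
      obtain ⟨C, N, hC, hCN⟩ := hle hM
      refine ⟨C / c, 2 * N, r₀, by positivity, hr₀, fun r hr u v hu hv => ?_⟩
      have hr0 : 0 ≤ r := hr₀.trans hr
      have hno : ∀ w ∈ Set.Ici (C / c * (1 + r) ^ (2 * N)), (P r).eval w ≠ 0 := by
        intro w hw h0
        have h₁ := sq_coeff_mul_abs_root_lt (hP.2 r) h0
        have h₂ := (le_abs_self _).trans (hCN r)
        have h₃ : C * (1 + ρ r) ^ N ≤ C * (1 + r) ^ (2 * N) := by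
          rw [pow_mul]
          gcongr
          simp only [ρ]
          nlinarith
        have h₄ : c * |w| ≤ (P r).coeff (d + 1) ^ 2 * |w| := by
          gcongr
          exact h r hr
        have h₅ : C * (1 + r) ^ (2 * N) ≤ c * |w| := by
          have : c * (C / c * (1 + r) ^ (2 * N)) ≤ c * |w| := by
            gcongr
            exact (Set.mem_Ici.1 hw).trans (le_abs_self w)
          calc _ = c * (C / c * (1 + r) ^ (2 * N)) := by field_simp
            _ ≤ _ := this
        linarith
      exact ⟨eval_pos_of_forall_ne_zero Set.ordConnected_Ici hno hu hv,
        eval_pos_of_forall_ne_zero Set.ordConnected_Ici hno hv hu⟩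

lemma pos {q : ℝ × ℝ → ℝ} (hq : q ∈ prodAlg lineAlg lineAlg) : TailConstant {z | 0 < q z} := by
  obtain ⟨d, P, hP, h⟩ := exists_family_of_mem hq
  convert eval_pos hP using 1
  ext ⟨r, u⟩
  simp [h]

lemma of_signSet {M : Set (ℝ × ℝ)} (hM : SignSet (prodAlg lineAlg lineAlg) M) :
    TailConstant M := by
  induction hM with
  | union _ _ i₁ i₂ =>
    refine i₁.combine i₂ fun r u v h₁ h₂ => ?_
    simp only [Set.mem_union, h₁, h₂]
  | basic p hp L hL =>
    have h₀ : TailConstant {z | p z = 0} := by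
      refine (pos hp).combine (pos (neg_mem' hp)) fun r u v h₁ h₂ => ?_
      simp only [Set.mem_ofPred_eq, neg_pos] at *
      rw [← not_iff_not, ← ne_eq, ← ne_eq, ne_iff_lt_or_gt, ne_iff_lt_or_gt, h₁, h₂]
    have h₁ : TailConstant {z | ∀ q ∈ L, 0 < q z} := by
      induction L with
      | nil => exact ⟨0, 0, 0, le_rfl, le_rfl, by simp⟩
      | cons q L ih =>
        refine (pos (hL q (by simp))).combine (ih fun p hp => hL p (by simp [hp]))
          fun r u v h₁ h₂ => ?_
        simp only [Set.mem_ofPred_eq, List.mem_cons, forall_eq_or_imp] at *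
        rw [h₁, h₂]
    refine h₀.combine h₁ fun r u v h₁ h₂ => ?_
    simp only [Set.mem_ofPred_eq] at *
    rw [h₁, h₂]

end TailConstant

/-- On a set described by sign conditions, a function which is bounded above where `ρ` is bounded
has polynomial growth in `ρ`. -/
theorem exists_polynomial_bound {Z : Type} {A : Subalgebra ℝ (Z → ℝ)} (hA : Eliminable A)
    {S : Set Z} (hS : SignSet A S) {ρ τ : Z → ℝ} (hρ : ρ ∈ A) (hτ : τ ∈ A) (hρ0 : ∀ z, 0 ≤ ρ z)
    (hb : ∀ R, ∃ K, ∀ z ∈ S, ρ z ≤ R → τ z ≤ K) :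
    ∃ C N, 0 ≤ C ∧ ∀ z ∈ S, τ z ≤ C * (1 + ρ z) ^ (N : ℕ) := by
  have hM : SignSet (prodAlg lineAlg lineAlg)
      {w : ℝ × ℝ | ∃ z, (w, z) ∈ {p : (ℝ × ℝ) × Z | p.2 ∈ S ∧ ρ p.2 ≤ p.1.1 ∧ p.1.2 ≤ τ p.2}} := by
    refine hA _ _ _ (.and ?_ (.and ?_ ?_))
    · exact hS.preimage le_comap_snd
    · exact SignSet.le (comp_snd_mem hρ) (comp_fst_mem (comp_fst_mem id_mem_lineAlg))
    · exact SignSet.le (comp_fst_mem snd_mem) (comp_snd_mem hτ)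
  obtain ⟨C, N, r₀, hC, hr₀, h⟩ := TailConstant.of_signSet hM
  refine ⟨C * (1 + r₀) ^ N, N, by positivity, fun z hz => ?_⟩
  have hz0 := hρ0 z
  by_contra! hlt
  obtain ⟨K, hK⟩ := hb (r₀ + ρ z)
  have h₁ : C * (1 + (r₀ + ρ z)) ^ N ≤ C * (1 + r₀) ^ N * (1 + ρ z) ^ N := by
    rw [mul_assoc, ← mul_pow]
    gcongr
    nlinarith
  obtain ⟨z', hz', hρz', hτz'⟩ := (h (r₀ + ρ z) (by linarith) (C * (1 + (r₀ + ρ z)) ^ N)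
    (max (C * (1 + (r₀ + ρ z)) ^ N) (K + 1)) le_rfl (le_max_left _ _)).1
    ⟨z, hz, by simpa using hr₀, (h₁.trans hlt.le)⟩
  have := hK z' hz' hρz'
  have := (le_max_right _ _).trans hτz'
  linarith

/-! ### The Łojasiewicz inequality and closed sets -/

/-- A Łojasiewicz inequality on closed sets described by sign conditions. -/
theorem exists_lojasiewicz {X : Type} [TopologicalSpace X] {A : Subalgebra ℝ (X → ℝ)}
    (hA : Eliminable A) (hcont : ∀ a ∈ A, Continuous a) {ρ : X → ℝ} (hρ : ρ ∈ A)
    (hρ0 : ∀ x, 0 ≤ ρ x) (hcpt : ∀ R, IsCompact {x | ρ x ≤ R}) {F : Set X} (hF : SignSet A F)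
    (hFc : IsClosed F) {a b : X → ℝ} (ha : a ∈ A) (hb : b ∈ A)
    (hab : ∀ x ∈ F, a x = 0 → b x = 0) :
    ∃ C N, ∀ x ∈ F,
      (b x ^ 2) ^ (N + 1) ≤ C * (b x ^ 2 * (1 + ρ x) + 1) ^ ((N : ℕ) + 1) * a x ^ 2 := by
  have hS : SignSet (prodAlg (prodAlg A lineAlg) lineAlg)
      {w : (X × ℝ) × ℝ | w.1.1 ∈ F ∧ w.1.2 * b w.1.1 = 1 ∧ w.2 * a w.1.1 = 1} := by
    refine .and ?_ (.and ?_ ?_)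
    · exact hF.preimage (φ := fun w : (X × ℝ) × ℝ => w.1.1)
        (comap_trans Prod.fst Prod.fst le_comap_fst le_comap_fst)
    · exact SignSet.eq (mul_mem' (comp_fst_mem snd_mem) (comp_fst_mem (comp_fst_mem hb)))
        (const_mem 1)
    · exact SignSet.eq (mul_mem' snd_mem (comp_fst_mem (comp_fst_mem ha))) (const_mem 1)
  obtain ⟨C, N, hC, h⟩ := exists_polynomial_bound ((hA.prod .line).prod .line) hS
    (ρ := fun w => ρ w.1.1 + w.1.2 ^ 2) (τ := fun w => w.2 ^ 2)
    (add_mem' (comp_fst_mem (comp_fst_mem hρ)) (pow_mem' (comp_fst_mem snd_mem) 2))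
    (pow_mem' snd_mem 2) (fun w => add_nonneg (hρ0 _) (sq_nonneg _)) (by
      intro R
      have hcpt' : IsCompact ({x | ρ x ≤ R} ∩ (F ∩ {x | 1 ≤ R * b x ^ 2})) :=
        (hcpt R).inter_right (hFc.inter
          (isClosed_le continuous_const (((hcont b hb).pow 2).const_mul R)))
      have hne : ∀ x ∈ {x | ρ x ≤ R} ∩ (F ∩ {x | 1 ≤ R * b x ^ 2}), a x ^ 2 ≠ 0 := by
        rintro x ⟨-, hxF, hx⟩ h0
        have hb0 := hab x hxF (by simpa using h0)
        simp only [Set.mem_ofPred_eq, hb0] at hx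
        norm_num at hx
      obtain ⟨K, hK⟩ := hcpt'.bddAbove_image
        (f := fun x => (a x ^ 2)⁻¹) (((hcont a ha).pow 2).continuousOn.inv₀ hne)
      refine ⟨K, ?_⟩
      rintro ⟨⟨x, u⟩, v⟩ ⟨hxF, hu, hv⟩ hR
      simp only at hxF hu hv hR
      have hx : x ∈ {x | ρ x ≤ R} ∩ (F ∩ {x | 1 ≤ R * b x ^ 2}) := by
        refine ⟨by simp only [Set.mem_ofPred_eq]; nlinarith [sq_nonneg u], hxF, ?_⟩
        simp only [Set.mem_ofPred_eq]
        calc 1 = (u * b x) ^ 2 := by rw [hu]; norm_num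
          _ = u ^ 2 * b x ^ 2 := by ring
          _ ≤ R * b x ^ 2 := by
            gcongr
            linarith [hρ0 x]
      have := hK ⟨x, hx, rfl⟩
      have hva : v = (a x)⁻¹ := eq_inv_of_mul_eq_one_left hv
      simpa [hva] using this)
  refine ⟨C, N, fun x hx => ?_⟩
  have hρx := hρ0 x
  by_cases hbx : b x = 0
  · simp only [hbx]
    simp
    positivity
  have hax : a x ≠ 0 := fun h => hbx (hab x hx h)
  have h₁ := h ((x, (b x)⁻¹), (a x)⁻¹) ⟨hx, by simp [hbx], by simp [hax]⟩
  simp only at h₁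
  have h₂ : (1 + (ρ x + (b x)⁻¹ ^ 2)) ^ N ≤ (1 + (ρ x + (b x)⁻¹ ^ 2)) ^ (N + 1) := by
    refine pow_le_pow_right₀ ?_ N.le_succ
    nlinarith [sq_nonneg (b x)⁻¹]
  have h₃ : (a x)⁻¹ ^ 2 ≤ C * (1 + (ρ x + (b x)⁻¹ ^ 2)) ^ (N + 1) := by
    exact h₁.trans (by gcongr)
  calc (b x ^ 2) ^ (N + 1) = (a x)⁻¹ ^ 2 * ((b x ^ 2) ^ (N + 1) * a x ^ 2) := by field_simp
    _ ≤ C * (1 + (ρ x + (b x)⁻¹ ^ 2)) ^ (N + 1) * ((b x ^ 2) ^ (N + 1) * a x ^ 2) := by gcongr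
    _ = C * ((1 + (ρ x + (b x)⁻¹ ^ 2)) * b x ^ 2) ^ (N + 1) * a x ^ 2 := by rw [mul_pow]; ring
    _ = _ := by
      congr 3
      field_simp
      ring

lemma list_prod_mem' {X : Type} {A : Subalgebra ℝ (X → ℝ)} {α : Type} {p : α → X → ℝ}
    (L : List α) (h : ∀ a ∈ L, p a ∈ A) : (fun x => (L.map fun a => p a x).prod) ∈ A := by
  induction L with
  | nil => simpa using const_mem (A := A) 1
  | cons a L ih =>
    simpa using mul_mem' (h a (by simp)) (ih fun b hb => h b (by simp [hb]))

/-- A closed set described by sign conditions is described by non-strict inequalities. -/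
theorem exists_nonstrict_description {X : Type} [TopologicalSpace X] {A : Subalgebra ℝ (X → ℝ)}
    (hA : Eliminable A) (hcont : ∀ a ∈ A, Continuous a) {ρ : X → ℝ} (hρ : ρ ∈ A)
    (hρ0 : ∀ x, 0 ≤ ρ x) (hcpt : ∀ R, IsCompact {x | ρ x ≤ R}) {F : Set X} (hF : SignSet A F)
    (hFc : IsClosed F) :
    ∃ D : List (List (X → ℝ)), (∀ H ∈ D, ∀ h ∈ H, h ∈ A) ∧
      ∀ x, x ∈ F ↔ ∀ H ∈ D, ∃ h ∈ H, h x ≤ 0 := by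
  suffices key : ∀ U, SignSet A U → U ⊆ Fᶜ → ∃ D : List (List (X → ℝ)),
      (∀ H ∈ D, ∀ h ∈ H, h ∈ A) ∧ (∀ x ∈ U, ∃ H ∈ D, ∀ h ∈ H, 0 < h x) ∧
      ∀ x, (∃ H ∈ D, ∀ h ∈ H, 0 < h x) → x ∉ F by
    obtain ⟨D, hD, h₁, h₂⟩ := key Fᶜ hF.compl subset_rfl
    refine ⟨D, hD, fun x => ?_⟩
    rw [← not_iff_not]
    push Not
    exact ⟨h₁ x, h₂ x⟩
  intro U hU hUF
  induction hU with
  | union _ _ i₁ i₂ =>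
    obtain ⟨D₁, h₁, h₂, h₃⟩ := i₁ (Set.subset_union_left.trans hUF)
    obtain ⟨D₂, k₁, k₂, k₃⟩ := i₂ (Set.subset_union_right.trans hUF)
    refine ⟨D₁ ++ D₂, ?_, ?_, ?_⟩
    · intro H hH
      rcases List.mem_append.1 hH with h | h
      exacts [h₁ H h, k₁ H h]
    · rintro x (hx | hx)
      · obtain ⟨H, hH, h⟩ := h₂ x hx
        exact ⟨H, List.mem_append_left _ hH, h⟩
      · obtain ⟨H, hH, h⟩ := k₂ x hx
        exact ⟨H, List.mem_append_right _ hH, h⟩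
    · rintro x ⟨H, hH, h⟩
      rcases List.mem_append.1 hH with h' | h'
      exacts [h₃ x ⟨H, h', h⟩, k₃ x ⟨H, h', h⟩]
  | basic p hp L hL =>
    have hb : (fun x => (L.map fun q => q x).prod) ∈ A := list_prod_mem' L hL
    have hF' : SignSet A (F ∩ {x | ∀ q ∈ L, 0 ≤ q x}) :=
      hF.inter (SignSet.list_forall L fun q hq => SignSet.le (const_mem 0) (hL q hq))
    have hFc' : IsClosed (F ∩ {x | ∀ q ∈ L, 0 ≤ q x}) := by
      refine hFc.inter ?_
      simp only [Set.ofPred_forall]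
      exact isClosed_iInter fun q => isClosed_iInter fun hq =>
        isClosed_le continuous_const (hcont q (hL q hq))
    obtain ⟨C, N, h⟩ := exists_lojasiewicz hA hcont hρ hρ0 hcpt hF' hFc' hp hb (by
      rintro x ⟨hxF, hx⟩ hpx
      by_contra hne
      refine hUF (a := x) ⟨hpx, fun q hq => (hx q hq).lt_of_ne' fun h0 => hne ?_⟩ hxF
      exact List.prod_eq_zero (List.mem_map.2 ⟨q, hq, h0⟩))
    let b : X → ℝ := fun x => (L.map fun q => q x).prod
    let g : X → ℝ := fun x =>
      (b x ^ 2) ^ (N + 1) - C * (b x ^ 2 * (1 + ρ x) + 1) ^ (N + 1) * p x ^ 2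
    have hg : g ∈ A := sub_mem' (pow_mem' (pow_mem' hb 2) _) (mul_mem' (mul_mem' (const_mem C)
      (pow_mem' (add_mem' (mul_mem' (pow_mem' hb 2) (add_mem' (const_mem 1) hρ)) (const_mem 1)) _))
      (pow_mem' hp 2))
    refine ⟨[g :: L], ?_, ?_, ?_⟩
    · simpa using ⟨hg, hL⟩
    · rintro x ⟨hpx, hx⟩
      have hbx : 0 < b x := by
        refine List.prod_pos ?_
        simpa using hx
      have hgx : 0 < g x := by
        simp only [g, hpx]
        norm_num
        positivity
      simpa using ⟨hgx, hx⟩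
    · rintro x ⟨H, hH, hx⟩ hxF
      rw [List.mem_singleton] at hH
      subst hH
      have := h x ⟨hxF, fun q hq => (hx q (by simp [hq])).le⟩
      have := hx g (by simp)
      simp only [g, b] at this
      linarith

/-! ### Polynomial functions and semialgebraic sets -/

lemma eval_mem_coordAlg {ι : Type} (p : MvPolynomial ι ℝ) :
    (fun x => MvPolynomial.eval x p) ∈ coordAlg ι := by
  induction p using MvPolynomial.induction_on with
  | C a => simpa using const_mem (A := coordAlg ι) a
  | add p q hp hq => simpa using add_mem' hp hq
  | mul_X p i hp => simpa using mul_mem' hp (coord_mem_coordAlg i)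

lemma exists_mvPolynomial_of_mem_coordAlg {ι : Type} {a : (ι → ℝ) → ℝ} (ha : a ∈ coordAlg ι) :
    ∃ p : MvPolynomial ι ℝ, ∀ x, a x = MvPolynomial.eval x p := by
  induction ha using Algebra.adjoin_induction with
  | mem x hx =>
    obtain ⟨i, rfl⟩ := hx
    exact ⟨MvPolynomial.X i, by simp⟩
  | algebraMap r => exact ⟨MvPolynomial.C r, by simp⟩
  | add x y _ _ hx hy =>
    obtain ⟨p, hp⟩ := hx
    obtain ⟨q, hq⟩ := hy
    exact ⟨p + q, by simp [hp, hq]⟩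
  | mul x y _ _ hx hy =>
    obtain ⟨p, hp⟩ := hx
    obtain ⟨q, hq⟩ := hy
    exact ⟨p * q, by simp [hp, hq]⟩

lemma isPolyMap_of_mem_coordAlg {n m : ℕ} {P : (Fin n → ℝ) → (Fin m → ℝ) → ℝ}
    (h : (fun z : Fin n ⊕ Fin m → ℝ => P (fun i => z (Sum.inl i)) fun j => z (Sum.inr j)) ∈
      coordAlg (Fin n ⊕ Fin m)) : IsPolyMap P := by
  obtain ⟨p, hp⟩ := exists_mvPolynomial_of_mem_coordAlg h
  exact ⟨p, fun x y => hp (Sum.elim x y)⟩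

lemma IsSemialgebraic.signSet {ι : Type} [Fintype ι] {S : Set (ι → ℝ)} (hS : IsSemialgebraic S) :
    SignSet (coordAlg ι) S := by
  obtain ⟨N, T, hT, rfl⟩ := hS
  convert SignSet.list_exists (A := coordAlg ι) (p := fun i x => x ∈ T i) (List.finRange N)
    fun i _ => ?_ using 1
  · ext x
    simp
  · obtain ⟨p, k, q, h⟩ := hT i
    convert (SignSet.eq_zero (eval_mem_coordAlg p)).and
      (SignSet.list_forall (List.finRange k) fun j _ => SignSet.pos (eval_mem_coordAlg (q j)))
      using 1
    ext x
    simp [h]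

lemma IsSemialgebraicFun.signSet_graph {n : ℕ} {f : (Fin n → ℝ) → ℝ} (hf : IsSemialgebraicFun f) :
    SignSet (prodAlg (coordAlg (Fin n)) lineAlg) {z : (Fin n → ℝ) × ℝ | f z.1 = z.2} := by
  refine IsSemialgebraic.signSet hf |>.preimage (φ := fun z : (Fin n → ℝ) × ℝ =>
    (Sum.elim z.1 fun _ => z.2 : Fin n ⊕ Unit → ℝ)) (coordAlg_le_comap ?_)
  rintro (i | _)
  · exact comp_fst_mem (coord_mem_coordAlg i)
  · exact snd_mem

lemma IsSemialgebraicFun.signSet_epigraph {n : ℕ} {f : (Fin n → ℝ) → ℝ}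
    (hf : IsSemialgebraicFun f) :
    SignSet (prodAlg (coordAlg (Fin n)) lineAlg) {z : (Fin n → ℝ) × ℝ | f z.1 ≤ z.2} := by
  have : SignSet (prodAlg (prodAlg (coordAlg (Fin n)) lineAlg) lineAlg)
      {w : ((Fin n → ℝ) × ℝ) × ℝ | f w.1.1 = w.2 ∧ w.2 ≤ w.1.2} := by
    refine .and ?_ (SignSet.le snd_mem (comp_fst_mem snd_mem))
    refine hf.signSet_graph.preimage (φ := fun w : ((Fin n → ℝ) × ℝ) × ℝ => (w.1.1, w.2))
      (prodAlg_le_comap (φ := fun w : ((Fin n → ℝ) × ℝ) × ℝ => (w.1.1, w.2)) ?_ le_comap_snd)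
    exact comap_trans (Prod.fst : ((Fin n → ℝ) × ℝ) × ℝ → _) Prod.fst le_comap_fst le_comap_fst
  convert this.exists_real using 1
  ext z
  simp

lemma continuous_of_mem_prodAlg {n : ℕ} {a : (Fin n → ℝ) × ℝ → ℝ}
    (ha : a ∈ prodAlg (coordAlg (Fin n)) lineAlg) : Continuous a := by
  let R : Subalgebra ℝ ((Fin n → ℝ) × ℝ → ℝ) :=
    { carrier := {F | Continuous F}
      mul_mem' := Continuous.mul
      add_mem' := Continuous.add
      algebraMap_mem' := fun c => continuous_const }
  refine prodAlg_le_comap (C := R) (φ := id) (coordAlg_le_comap fun i => ?_)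
    (lineAlg_le_comap ?_) ha
  · exact (continuous_apply i).comp continuous_fst
  · exact continuous_snd

lemma isCompact_sum_sq_le (n : ℕ) (R : ℝ) : IsCompact {x : Fin n → ℝ | ∑ i, x i ^ 2 ≤ R} := by
  refine Metric.isCompact_of_isClosed_isBounded (isClosed_le (by fun_prop) continuous_const) ?_
  refine (Metric.isBounded_Icc (fun _ => -(R + 1)) fun _ => R + 1).subset fun x hx => ?_
  have h : ∀ i, x i ^ 2 ≤ R := fun i =>
    (Finset.single_le_sum (f := fun i => x i ^ 2) (fun i _ => sq_nonneg _)
      (Finset.mem_univ i)).trans hx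
  constructor <;> intro i <;> simp only <;> nlinarith [h i]

lemma isCompact_sum_sq_add_sq_le (n : ℕ) (R : ℝ) :
    IsCompact {z : (Fin n → ℝ) × ℝ | ∑ i, z.1 i ^ 2 + z.2 ^ 2 ≤ R} := by
  refine ((isCompact_sum_sq_le n R).prod
    (isCompact_Icc (a := -(R + 1)) (b := R + 1))).of_isClosed_subset
      (isClosed_le (by fun_prop) continuous_const) ?_
  rintro ⟨x, t⟩ hz
  have hx : 0 ≤ ∑ i, x i ^ 2 := Finset.sum_nonneg fun i _ => sq_nonneg _
  simp only [Set.mem_ofPred_eq] at hz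
  refine ⟨?_, ?_, ?_⟩
  · simp only [Set.mem_ofPred_eq]
    nlinarith [sq_nonneg t]
  · simp only
    nlinarith
  · simp only
    nlinarith

lemma sum_sq_mem_coordAlg (n : ℕ) : (fun x : Fin n → ℝ => ∑ i, x i ^ 2) ∈ coordAlg (Fin n) :=
  sum_mem' _ fun i _ => pow_mem' (coord_mem_coordAlg i) 2

lemma exists_polynomial_bound_of_bounded_on_compact {n : ℕ} {f : (Fin n → ℝ) → ℝ}
    (hsa : IsSemialgebraicFun f)
    (hcb : ∀ C : Set (Fin n → ℝ), IsCompact C → ∃ K : ℝ, ∀ x ∈ C, |f x| ≤ K) :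
    ∃ K ∈ coordAlg (Fin n), ∀ x, 0 < K x ∧ |f x| ≤ K x := by
  obtain ⟨C, N, hC, h⟩ := exists_polynomial_bound ((Eliminable.coord n).prod .line)
    hsa.signSet_graph (ρ := fun z => ∑ i, z.1 i ^ 2) (τ := fun z => z.2 ^ 2)
    (comp_fst_mem (sum_sq_mem_coordAlg n)) (pow_mem' snd_mem 2)
    (fun z => Finset.sum_nonneg fun i _ => sq_nonneg _) (by
      intro R
      obtain ⟨K, hK⟩ := hcb _ (isCompact_sum_sq_le n R)
      refine ⟨K ^ 2, ?_⟩
      rintro ⟨x, t⟩ hz hR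
      have := hK x hR
      rw [show t = f x from hz.symm]
      exact sq_le_sq.2 (this.trans (le_abs_self K)))
  refine ⟨fun x => 1 + C * (1 + ∑ i, x i ^ 2) ^ N, add_mem' (const_mem 1) (mul_mem' (const_mem C)
    (pow_mem' (add_mem' (const_mem 1) (sum_sq_mem_coordAlg n)) N)), fun x => ?_⟩
  have hx : 0 ≤ ∑ i, x i ^ 2 := Finset.sum_nonneg fun i _ => sq_nonneg _
  refine ⟨by positivity, ?_⟩
  have := h (x, f x) rfl
  simp only at this
  rw [← sq_abs] at this
  nlinarith [sq_nonneg (|f x| - 1)]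

lemma le_growthAlg (n : ℕ) (h0 : ∀ z : (Fin n → ℝ) × ℝ, 0 ≤ ∑ i, z.1 i ^ 2 + z.2 ^ 2) :
    prodAlg (coordAlg (Fin n)) lineAlg ≤
      growthAlg (fun z : (Fin n → ℝ) × ℝ => ∑ i, z.1 i ^ 2 + z.2 ^ 2) h0 := by
  refine prodAlg_le_comap (C := growthAlg _ h0) (φ := id) (coordAlg_le_comap fun i => ?_)
    (lineAlg_le_comap ?_)
  · refine mem_growthAlg_of_sq_le fun z => ?_
    have := Finset.single_le_sum (f := fun i => z.1 i ^ 2) (fun i _ => sq_nonneg _)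
      (Finset.mem_univ i)
    simp only [id] at *
    nlinarith [sq_nonneg z.2]
  · refine mem_growthAlg_of_sq_le fun z => ?_
    have : 0 ≤ ∑ i, z.1 i ^ 2 := Finset.sum_nonneg fun i _ => sq_nonneg _
    simp only [id] at *
    linarith

/-- Finitely many polynomials are dominated by a positive polynomial in `x` alone on the region
where the last coordinate is bounded by a polynomial in `x`. -/
lemma exists_uniform_bound {n : ℕ} {K : (Fin n → ℝ) → ℝ} (hK : K ∈ coordAlg (Fin n))
    (L : List ((Fin n → ℝ) × ℝ → ℝ)) (hL : ∀ h ∈ L, h ∈ prodAlg (coordAlg (Fin n)) lineAlg) :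
    ∃ B ∈ coordAlg (Fin n), ∀ x, 0 < B x ∧ ∀ h ∈ L, ∀ t, |t| ≤ |K x| → |h (x, t)| ≤ B x := by
  have h0 : ∀ z : (Fin n → ℝ) × ℝ, 0 ≤ ∑ i, z.1 i ^ 2 + z.2 ^ 2 := fun z => by positivity
  obtain ⟨C, N, hC, h⟩ := exists_uniform_growth L fun F hF => le_growthAlg n h0 (hL F hF)
  refine ⟨fun x => 1 + C * (1 + (∑ i, x i ^ 2 + K x ^ 2)) ^ N, add_mem' (const_mem 1)
    (mul_mem' (const_mem C) (pow_mem' (add_mem' (const_mem 1)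
      (add_mem' (sum_sq_mem_coordAlg n) (pow_mem' hK 2))) N)), fun x => ⟨by positivity, ?_⟩⟩
  intro F hF t ht
  refine (h F hF (x, t)).trans ?_
  have : C * (1 + (∑ i, x i ^ 2 + t ^ 2)) ^ N ≤ C * (1 + (∑ i, x i ^ 2 + K x ^ 2)) ^ N := by
    have := sq_le_sq.2 ht
    gcongr
  simp only
  linarith

/-- If `Q` is nonnegative and its zeros over `x` in the box are nonempty, the optimistic value is
determined by the values of `P` on these zeros. -/
lemma valOpt_eq_of_zeros {n m : ℕ} {P Q : (Fin n → ℝ) → (Fin m → ℝ) → ℝ} {Y : Set (Fin m → ℝ)}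
    {x : Fin n → ℝ} {c : ℝ} (hQ : ∀ y, 0 ≤ Q x y) (h : ∃ y ∈ Y, Q x y = 0 ∧ P x y = c)
    (hc : ∀ y ∈ Y, Q x y = 0 → c ≤ P x y) : valOpt P Q Y x = c := by
  obtain ⟨y, hy, hQy, rfl⟩ := h
  refine le_antisymm (iInf₂_le y ⟨hy, fun y' _ => hQy.trans_le (hQ y')⟩) (le_iInf₂ fun y' hy' => ?_)
  exact EReal.coe_le_coe_iff.2 (hc y' hy'.1 (le_antisymm ((hy'.2 y hy).trans_eq hQy) (hQ y')))

/-- every semi-algebraic, lower semicontinuous function bounded on compact sets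
is the optimistic value function of a polynomial bilevel problem over a bounded box. -/
theorem sa_lsc_cb_is_bounded_box_optimistic_value (n : ℕ) (f : (Fin n → ℝ) → ℝ)
    (hsa : IsSemialgebraicFun f) (hlsc : LowerSemicontinuous f)
    (hcb : ∀ C : Set (Fin n → ℝ), IsCompact C → ∃ K : ℝ, ∀ x ∈ C, |f x| ≤ K) :
    ∃ (m : ℕ) (P Q : (Fin n → ℝ) → (Fin m → ℝ) → ℝ) (a b : Fin m → ℝ),
      IsPolyMap P ∧ IsPolyMap Q ∧
      ∀ x, valOpt P Q (boundedBox a b) x = ((f x : ℝ) : EReal) := by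
  obtain ⟨K, hK, hKf⟩ := exists_polynomial_bound_of_bounded_on_compact hsa hcb
  obtain ⟨D, hDA, hD⟩ := exists_nonstrict_description ((Eliminable.coord n).prod .line)
    (fun a ha => continuous_of_mem_prodAlg ha)
    (add_mem' (comp_fst_mem (sum_sq_mem_coordAlg n)) (pow_mem' snd_mem 2))
    (fun z => by positivity) (isCompact_sum_sq_add_sq_le n) hsa.signSet_epigraph
    hlsc.isClosed_epigraph
  simp only [Prod.forall, Set.mem_ofPred_eq] at hD
  obtain ⟨B, hB, hBh⟩ := exists_uniform_bound hK D.flatten fun h hh => by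
    obtain ⟨H, hH, hh⟩ := List.mem_flatten.1 hh
    exact hDA H hH h hh
  let P : (Fin n → ℝ) → (Fin (D.length + 1) → ℝ) → ℝ := fun x y => K x * y 0
  let Q : (Fin n → ℝ) → (Fin (D.length + 1) → ℝ) → ℝ := fun x y =>
    ∑ i : Fin D.length, ((D[i]).map fun h => h (x, K x * y 0) + B x * y i.succ).prod ^ 2
  refine ⟨D.length + 1, P, Q, Fin.cons (-1) fun _ => 0, fun _ => 1, ?_, ?_, fun x => ?_⟩
  · refine isPolyMap_of_mem_coordAlg (mul_mem' ?_ (coord_mem_coordAlg _))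
    exact coordAlg_le_comap (φ := fun (z : Fin n ⊕ Fin (D.length + 1) → ℝ) i => z (Sum.inl i))
      (fun i => coord_mem_coordAlg (Sum.inl i)) hK
  · refine isPolyMap_of_mem_coordAlg (sum_mem' _ fun i _ => pow_mem' (list_prod_mem' _ ?_) 2)
    have hle := coordAlg_le_comap (φ := fun (z : Fin n ⊕ Fin (D.length + 1) → ℝ) i => z (Sum.inl i))
      fun i => coord_mem_coordAlg (Sum.inl i)
    intro h hh
    refine add_mem' ?_ (mul_mem' (hle hB) (coord_mem_coordAlg _))
    exact prodAlg_le_comap (φ := fun z : Fin n ⊕ Fin (D.length + 1) → ℝ =>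
      ((fun i => z (Sum.inl i)), K (fun i => z (Sum.inl i)) * z (Sum.inr 0))) hle
      (lineAlg_le_comap (mul_mem' (hle hK) (coord_mem_coordAlg _)))
      (hDA _ (List.getElem_mem _) h hh)
  obtain ⟨hK0, hfK⟩ := hKf x
  obtain ⟨hB0, hBh⟩ := hBh x
  refine valOpt_eq_of_zeros (fun y => Finset.sum_nonneg fun i _ => sq_nonneg _) ?_ ?_
  · choose h hh hle using fun i : Fin D.length => (hD x (f x)).1 le_rfl D[i] (List.getElem_mem _)
    have hx : K x * (f x / K x) = f x := by field_simp
    refine ⟨Fin.cons (f x / K x) fun i => -h i (x, f x) / B x, ?_, ?_, ?_⟩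
    · intro i
      refine Fin.cases ?_ (fun i => ?_) i
      · simp only [Fin.cons_zero, Set.mem_Icc]
        rw [← abs_le, abs_div, abs_of_pos hK0]
        exact (div_le_one hK0).2 hfK
      · simp only [Fin.cons_succ, Set.mem_Icc]
        refine ⟨div_nonneg (by linarith [hle i]) hB0.le, (div_le_one hB0).2 ?_⟩
        exact (neg_le_abs _).trans (hBh (h i)
          (List.mem_flatten.2 ⟨_, List.getElem_mem _, hh i⟩) (f x) (hfK.trans (le_abs_self _)))
    · refine Finset.sum_eq_zero fun i _ => ?_
      rw [sq_eq_zero_iff, List.prod_eq_zero_iff, List.mem_map]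
      refine ⟨h i, hh i, ?_⟩
      simp only [Fin.cons_zero, Fin.cons_succ, hx]
      field_simp
      ring
    · simp only [P, Fin.cons_zero, hx]
  · intro y hy hQ
    refine (hD x (K x * y 0)).2 fun H hH => ?_
    obtain ⟨i, hi, rfl⟩ := List.mem_iff_getElem.1 hH
    have := (Finset.sum_eq_zero_iff_of_nonneg fun i _ => sq_nonneg _).1 hQ ⟨i, hi⟩
      (Finset.mem_univ _)
    rw [sq_eq_zero_iff, List.prod_eq_zero_iff, List.mem_map] at this
    obtain ⟨h, hh, h0⟩ := this
    refine ⟨h, hh, ?_⟩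
    have hs : 0 ≤ y (Fin.succ ⟨i, hi⟩) := by
      simpa only [Fin.cons_succ] using (hy (Fin.succ ⟨i, hi⟩)).1
    nlinarith [mul_nonneg hB0.le hs]
end
end
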